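/- arXiv:1401.7722 — 3 statements merged into one kernel-verified Lean document; each statement's English description precedes it below -/
import Mathlib

section
/- Assume mu_l ≤ mu_h. If F(y_0) ≠ 0, then 1 < 1/eta_1 < y_0. -/
/-- If `x` is a root of `a x² + e x - c` with `a, c, x > 0`, this identity shows that the quadratic
has the sign of `z - x` at every `z > 0`. -/
lemma mul_quadratic_eq_of_root {a e c x z : ℝ} (hx : a * x ^ 2 + e * x - c = 0) :
    x * (a * z ^ 2 + e * z - c) = (z - x) * (a * x * z + c) := by
  linear_combination z * hx

lemma quadratic_inv_root {A E C l η : ℝ} (hA : 0 < A) (hl : 0 < l) (hC : 0 < C)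
    (hη : η = (E + Real.sqrt (E ^ 2 + 4 * A * C)) / (2 * A * l)) :
    0 < η ∧ C * (1 / η) ^ 2 + E * l * (1 / η) - A * l ^ 2 = 0 := by
  have hAC : 0 < A * C := mul_pos hA hC
  have hs : Real.sqrt (E ^ 2 + 4 * A * C) ^ 2 = E ^ 2 + 4 * A * C :=
    Real.sq_sqrt (by nlinarith [sq_nonneg E])
  have hlt : |E| < Real.sqrt (E ^ 2 + 4 * A * C) := by
    rw [← Real.sqrt_sq_eq_abs]
    exact Real.sqrt_lt_sqrt (sq_nonneg E) (by linarith)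
  have hpos : 0 < η := by
    rw [hη]
    have := neg_abs_le E
    exact div_pos (by linarith) (by positivity)
  refine ⟨hpos, ?_⟩
  have hmul : 2 * A * l * η - E = Real.sqrt (E ^ 2 + 4 * A * C) := by
    rw [hη]
    field_simp
    ring
  rw [← hmul] at hs
  have hroot : C + E * l * η - A * l ^ 2 * η ^ 2 = 0 := by
    apply mul_left_cancel₀ hA.ne'
    linear_combination (-1 / 4) * hs
  field_simp
  linear_combination hroot

/-- The point `w = 1 / (√A + √B)²` with `A = p h` and `B = (1 - p) (1 - h)` is a root of the
discriminant `(A - B)² w² - 2 (A + B) w + 1`, and it is larger than `1` if `p < h`. -/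
lemma branch_point_spec {p h w : ℝ} (hp : 0 < p) (hph : p < h) (hh : h < 1) (hs : p + h < 1)
    (hw : w = (p * h + (1 - p) * (1 - h) - 2 * Real.sqrt (p * h * (1 - p) * (1 - h)))
      / (p * h - (1 - p) * (1 - h)) ^ 2) :
    1 < w ∧ (h - (1 - p)) ^ 2 * w ^ 2 - 2 * (h + (1 - p) - 2 * (1 - p) * h) * w + 1 = 0 := by
  have hp' : 0 < 1 - p := by linarith
  have hh' : 0 < 1 - h := by linarith
  have hh0 : 0 < h := by linarith
  set r := Real.sqrt (p * h * (1 - p) * (1 - h)) with hr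
  have hr0 : 0 ≤ r := Real.sqrt_nonneg _
  have hrsq : r ^ 2 = p * h * (1 - p) * (1 - h) := Real.sq_sqrt (by positivity)
  set S := p * h + (1 - p) * (1 - h) with hS
  have hSpos : 0 < S := by positivity
  have hdiff : (p * h - (1 - p) * (1 - h)) ^ 2 = (S - 2 * r) * (S + 2 * r) := by
    rw [hS]
    linear_combination (4 : ℝ) * hrsq
  have hne : 0 < (p * h - (1 - p) * (1 - h)) ^ 2 := by
    have : p * h - (1 - p) * (1 - h) < 0 := by linarith
    exact sq_pos_of_neg this
  have hplus : 0 < S + 2 * r := by linarith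
  have hminus : 0 < S - 2 * r := by
    rw [hdiff] at hne
    exact (pos_iff_pos_of_mul_pos hne).2 hplus
  have hw' : w = 1 / (S + 2 * r) := by
    rw [hw, hdiff]
    field_simp
  have hlt : S + 2 * r < 1 := by
    have h1 : 0 < 1 - S := by
      have : 1 - S = h * (1 - p) + p * (1 - h) := by rw [hS]; ring
      rw [this]
      positivity
    have h2 : (2 * r) ^ 2 < (1 - S) ^ 2 := by
      have : (1 - S) ^ 2 - (2 * r) ^ 2 = (h - p) ^ 2 := by
        rw [hS]
        linear_combination (-4 : ℝ) * hrsq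
      have : 0 < (h - p) ^ 2 := by
        have : 0 < h - p := by linarith
        positivity
      linarith
    have := lt_of_pow_lt_pow_left₀ 2 h1.le h2
    linarith
  refine ⟨by rw [hw', lt_div_iff₀ hplus]; linarith, ?_⟩
  have h3 : (h - (1 - p)) ^ 2 = (S - 2 * r) * (S + 2 * r) := by
    rw [← hdiff]
    ring
  have h4 : h + (1 - p) - 2 * (1 - p) * h = S := by
    rw [hS]
    ring
  rw [h3, h4, hw']
  field_simp
  ring

/-- if `F(y_0) ≠ 0`, then `1 < 1/eta_1 < y_0`. -/
theorem inv_eta1_between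
    (p q mh ml : ℝ)
    (hp : p ∈ Set.Ioo (0:ℝ) 1) (hq : q ∈ Set.Ioo (0:ℝ) 1)
    (hmh : mh ∈ Set.Ioo (0:ℝ) 1) (hml : ml ∈ Set.Ioo (0:ℝ) 1)
    (hpar : p + q + mh + ml = 1)
    (hrho : p / mh + q / ml < 1)
    (hmu : ml ≤ mh)
    (F : ℝ → ℝ)
    (hF : ∀ y, F y = ((1-p) + mh - 2*(1-p)*ml)*q*y^2
        + (((1-p) + mh - 2*(1-p)*ml)*(1-q) + 2*(1-p)*q*ml - 1)*y
        + 2*(1-p)*(1-q)*ml)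
    (y0 : ℝ)
    (hy0 : y0 = (p*mh + (1-p)*(1-mh) - 2*Real.sqrt (p*mh*(1-p)*(1-mh)))
        / ((p*mh - (1-p)*(1-mh))^2 * q) - (1-q)/q)
    (eta1 : ℝ)
    (heta1 : eta1 = ((1 - mh*(1-q) - (1-p)*(1-q)*(1-ml) - (1-p)*q*ml)
        + Real.sqrt ((1 - mh*(1-q) - (1-p)*(1-q)*(1-ml) - (1-p)*q*ml)^2
            + 4*(1-p)*(1-q)*(mh - (1-p)*ml)*(1-ml)*q))
        / (2*(1-p)*(1-q)*ml))
    (hFy0 : F y0 ≠ 0) :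
    1 < 1/eta1 ∧ 1/eta1 < y0 := by
  obtain ⟨hp0, hp1⟩ := hp
  obtain ⟨hq0, hq1⟩ := hq
  obtain ⟨hh0, hh1⟩ := hmh
  obtain ⟨hl0, hl1⟩ := hml
  have hb : 0 < 1 - p := by linarith
  have hq' : 0 < 1 - q := by linarith
  have hl' : 0 < 1 - ml := by linarith
  have hload : p * ml + q * mh < mh * ml := by
    rw [div_add_div _ _ hh0.ne' hl0.ne', div_lt_one (by positivity)] at hrho
    linarith
  have hph : p < mh := by nlinarith [mul_pos hq0 hh0]
  have hbl : 0 < mh - (1 - p) * ml := by nlinarith [mul_pos hp0 hl0]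
  obtain ⟨hw1, hd⟩ := branch_point_spec hp0 hph hh1 (by linarith) rfl
  set w := (p * mh + (1 - p) * (1 - mh) - 2 * Real.sqrt (p * mh * (1 - p) * (1 - mh)))
      / (p * mh - (1 - p) * (1 - mh)) ^ 2 with hw
  have hwy : w = 1 - q + q * y0 := by
    rw [hy0, ← div_div, ← hw]
    field_simp
    ring
  clear_value w
  have hy1 : 1 < y0 := by nlinarith
  set E := 1 - mh * (1 - q) - (1 - p) * (1 - q) * (1 - ml) - (1 - p) * q * ml with hE
  obtain ⟨hη, hroot⟩ := quadratic_inv_root (A := (1 - p) * (1 - q)) (E := E)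
    (C := (mh - (1 - p) * ml) * (1 - ml) * q) (l := ml) (η := eta1)
    (by positivity) hl0 (by positivity) (by rw [heta1]; ring_nf)
  have hx : 0 < 1 / eta1 := by positivity
  have hpos (z : ℝ) (hz : 0 < z) :
      0 < (mh - (1 - p) * ml) * (1 - ml) * q * (1 / eta1) * z + (1 - p) * (1 - q) * ml ^ 2 := by
    positivity
  have hkey : F y0 ^ 2 = 4 * (1 - p) * w * (y0 - 1) *
      ((mh - (1 - p) * ml) * (1 - ml) * q * y0 ^ 2 + E * ml * y0
        - (1 - p) * (1 - q) * ml ^ 2) := by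
    rw [hF, hE]
    rw [hwy] at hd ⊢
    linear_combination y0 ^ 2 * hd
  constructor
  · have h1 := mul_quadratic_eq_of_root (z := 1) hroot
    have h2 : (mh - (1 - p) * ml) * (1 - ml) * q * 1 ^ 2 + E * ml * 1
        - (1 - p) * (1 - q) * ml ^ 2 < 0 := by
      have : (mh - (1 - p) * ml) * (1 - ml) * q * 1 ^ 2 + E * ml * 1
        - (1 - p) * (1 - q) * ml ^ 2 = p * ml + q * mh - mh * ml := by rw [hE]; ring
      linarith
    have h3 := mul_neg_of_pos_of_neg hx h2
    rw [h1] at h3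
    linarith [neg_of_mul_neg_left h3 (hpos 1 one_pos).le]
  · have h1 := mul_quadratic_eq_of_root (z := y0) hroot
    have hF2 : 0 < F y0 ^ 2 := by positivity
    rw [hkey] at hF2
    have hfac : 0 < 4 * (1 - p) * w * (y0 - 1) := by
      have : 0 < w := by linarith
      have : 0 < y0 - 1 := by linarith
      positivity
    have h3 := mul_pos hx (pos_of_mul_pos_right hF2 hfac.le)
    rw [h1] at h3
    linarith [pos_of_mul_pos_left h3 (hpos y0 (by linarith)).le]
end

section
/- Assume mu_l ≤ mu_h and F(y_0) > 0 (exact geometric decay case). Then lim_{j→∞} pi_{0,j}/eta_1^j = C_{l,1}, where C_{l,1} = 2·a·F(1/eta_1)/(q/eta_1 + 1−q) with a = (pi_{0,0}/(2(1−p)·mu_l))·eta_1/(eta_1−eta_2), and C_{l,1} ≠ 0. -/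
/-- The balance equations of the discrete-time preemptive priority queue
(early arrival system). -/
def BalanceEquations (p q mh ml : ℝ) (pi : ℕ → ℕ → ℝ) : Prop :=
  ((1 - ((1-p)*(1-q) + p*(1-q)*mh + (1-p)*q*ml)) * pi 0 0 =
      (1-p)*(1-q)*mh * pi 1 0 + (1-p)*(1-q)*ml * pi 0 1) ∧
  (∀ i : ℕ, 1 ≤ i →
    (1 - ((1-p)*(1-q)*(1-mh) + p*(1-q)*mh)) * pi i 0 =
      p*(1-q)*(1-mh) * pi (i-1) 0 + (1-p)*(1-q)*mh * pi (i+1) 0) ∧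
  (∀ j : ℕ, 1 ≤ j →
    (1 - ((1-p)*(1-q)*(1-ml) + p*(1-q)*mh + (1-p)*q*ml)) * pi 0 j =
      (p*q*mh + (1-p)*q*(1-ml)) * pi 0 (j-1) + (1-p)*(1-q)*ml * pi 0 (j+1) +
      (1-p)*q*mh * pi 1 (j-1) + (1-p)*(1-q)*mh * pi 1 j) ∧
  (∀ i j : ℕ, 1 ≤ i → 1 ≤ j →
    (1 - ((1-p)*(1-q)*(1-mh) + p*(1-q)*mh)) * pi i j =
      p*(1-q)*(1-mh) * pi (i-1) j + (1-p)*(1-q)*mh * pi (i+1) j +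
      (1-p)*q*mh * pi (i+1) (j-1) + (p*q*mh + (1-p)*q*(1-mh)) * pi i (j-1) +
      p*q*(1-mh) * pi (i-1) (j-1))

open Filter Topology

/-- The mass `∑_{n ≥ k} g n` that a summable sequence leaves from index `k` on. -/
noncomputable def tailSum (g : ℕ → ℝ) (k : ℕ) : ℝ := ∑' n, g (n + k)

lemma tailSum_zero (g : ℕ → ℝ) : tailSum g 0 = ∑' n, g n := rfl

lemma tailSum_succ {g : ℕ → ℝ} (hg : Summable g) (k : ℕ) :
    tailSum g (k + 1) = tailSum g k - g k := by
  have h := ((summable_nat_add_iff k).2 hg).tsum_eq_zero_add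
  simp only [tailSum]
  rw [h, zero_add, add_sub_cancel_left]
  exact tsum_congr fun n => by congr 1; ring

lemma tailSum_nonneg {g : ℕ → ℝ} (hg : ∀ k, 0 ≤ g k) (k : ℕ) : 0 ≤ tailSum g k :=
  tsum_nonneg fun _ => hg _

/-- The generating function of the tails, in terms of that of the sequence. -/
lemma hasSum_tailSum_mul_pow {g : ℕ → ℝ} (hg : ∀ k, 0 ≤ g k) {R A z G : ℝ} (hR : 1 ≤ R)
    (hgR : Summable fun k => g k * R ^ k) (hA : HasSum g A) (hz0 : 0 ≤ z) (hzR : z ≤ R)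
    (hz1 : z ≠ 1) (hG : HasSum (fun k => g k * z ^ k) G) :
    HasSum (fun k => tailSum g k * z ^ k) ((z * G - A) / (z - 1)) := by
  have hz1' : z - 1 ≠ 0 := sub_ne_zero.2 hz1
  rw [hasSum_iff_tendsto_nat_of_nonneg fun k => mul_nonneg (tailSum_nonneg hg k) (by positivity)]
  have key : ∀ N, ∑ k ∈ Finset.range N, tailSum g k * z ^ k =
      (tailSum g N * z ^ N - A + z * ∑ k ∈ Finset.range N, g k * z ^ k) / (z - 1) := by
    intro N
    induction N with
    | zero => simp [tailSum_zero, hA.tsum_eq]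
    | succ N ih =>
      rw [Finset.sum_range_succ, ih, Finset.sum_range_succ, tailSum_succ hA.summable]
      field_simp
      ring
  have htail : Tendsto (fun N => tailSum g N * z ^ N) atTop (𝓝 0) := by
    refine squeeze_zero (fun N => mul_nonneg (tailSum_nonneg hg N) (by positivity)) (fun N => ?_)
      (tendsto_sum_nat_add fun k => g k * R ^ k)
    rw [tailSum, ← tsum_mul_right]
    refine Summable.tsum_le_tsum (fun n => ?_)
      (((summable_nat_add_iff N).2 hA.summable).mul_right _)
      ((summable_nat_add_iff N).2 hgR)
    refine mul_le_mul_of_nonneg_left ?_ (hg _)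
    exact (pow_le_pow_left₀ hz0 hzR N).trans (pow_le_pow_right₀ hR (by omega))
  simp only [key]
  have := ((htail.sub_const A).add (hG.tendsto_sum_nat.const_mul z)).div_const (z - 1)
  convert this using 2
  ring

/-- Re-expansion of a power series with nonnegative coefficients in `q * y + t` as one in `y`. -/
lemma hasSum_binomial_expand {a : ℕ → ℝ} (ha : ∀ k, 0 ≤ a k) {q t y S : ℝ} (hq : 0 ≤ q)
    (ht : 0 ≤ t) (hy : 0 ≤ y) (hS : HasSum (fun k => a k * (q * y + t) ^ k) S) :
    HasSum (fun m => (∑' k, a k * (q ^ m * t ^ (k - m) * k.choose m)) * y ^ m) S := by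
  set f : ℕ × ℕ → ℝ := fun x => a x.1 * (q ^ x.2 * t ^ (x.1 - x.2) * x.1.choose x.2) * y ^ x.2
  have hf0 : 0 ≤ f := fun x => mul_nonneg (mul_nonneg (ha _) (by positivity)) (by positivity)
  have hrow : ∀ k, HasSum (fun m => f (k, m)) (a k * (q * y + t) ^ k) := by
    intro k
    rw [add_pow, Finset.mul_sum]
    have : ∀ m ∉ Finset.range (k + 1), f (k, m) = 0 := by
      intro m hm
      simp [f, Nat.choose_eq_zero_of_lt (by simpa using hm : k < m)]
    convert hasSum_sum_of_ne_finset_zero (L := .unconditional ℕ) this using 1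
    refine Finset.sum_congr rfl fun m _ => ?_
    simp only [f, mul_pow]
    ring
  have hsum : Summable f := by
    rw [summable_prod_of_nonneg hf0]
    refine ⟨fun k => (hrow k).summable, ?_⟩
    simpa only [(hrow _).tsum_eq] using hS.summable
  have htot : HasSum f S := by
    have h := hsum.hasSum
    have h2 := h.prod_fiberwise hrow
    rwa [h2.unique hS] at h
  have hswap : HasSum (fun x : ℕ × ℕ => f x.swap) S := (Equiv.prodComm ℕ ℕ).hasSum_iff.2 htot
  have h3 := hswap.prod_fiberwise fun m => (hswap.summable.prod_factor m).hasSum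
  convert h3 using 2 with m
  rw [← tsum_mul_right]
  rfl

/-- A convergent power series that vanishes on `(0, 1)` is zero. -/
lemma coeff_eq_zero_of_hasSum_zero {c : ℕ → ℝ}
    (h : ∀ y ∈ Set.Ioo (0 : ℝ) 1, HasSum (fun n => c n * y ^ n) 0) : c = 0 := by
  by_contra hc
  obtain ⟨N, hN⟩ := Function.ne_iff.1 hc
  have hex : ∃ n, c n ≠ 0 := ⟨N, hN⟩
  classical
  set M := Nat.find hex
  have hM : c M ≠ 0 := Nat.find_spec hex
  have hlt : ∀ n < M, c n = 0 := fun n hn => by simpa using Nat.find_min hex hn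
  have hshift : ∀ y ∈ Set.Ioo (0 : ℝ) 1, HasSum (fun n => c (n + M) * y ^ n) 0 := by
    intro y hy
    have h1 := (hasSum_nat_add_iff' M).2 (h y hy)
    rw [Finset.sum_eq_zero fun n hn => by rw [hlt n (Finset.mem_range.1 hn), zero_mul],
      sub_zero] at h1
    have h2 := h1.mul_right (y ^ M)⁻¹
    rw [zero_mul] at h2
    have : y ^ M ≠ 0 := (pow_pos hy.1 M).ne'
    simpa only [pow_add, ← mul_assoc, mul_inv_cancel_right₀ this] using h2
  have habs : Summable fun n => |c (n + M)| * (1 / 2 : ℝ) ^ n := by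
    have := (hshift (1 / 2) ⟨by norm_num, by norm_num⟩).summable.abs
    simpa only [abs_mul, abs_pow, abs_of_pos (by norm_num : (0 : ℝ) < 1 / 2)] using this
  have hcont : ContinuousOn (fun y : ℝ => ∑' n, c (n + M) * y ^ n) (Set.Icc 0 (1 / 2)) := by
    refine continuousOn_tsum (fun n => by fun_prop) habs fun n y hy => ?_
    rw [norm_mul, norm_pow, Real.norm_eq_abs, Real.norm_eq_abs, abs_of_nonneg hy.1]
    exact mul_le_mul_of_nonneg_left (pow_le_pow_left₀ hy.1 hy.2 n) (abs_nonneg _)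
  have h0 := (hcont 0 ⟨le_rfl, by norm_num⟩).mono (s := Set.Ioo 0 (1 / 2))
    (fun y hy => ⟨hy.1.le, hy.2.le⟩)
  have hval : ∑' n, c (n + M) * (0 : ℝ) ^ n = c M := by
    rw [tsum_eq_single 0 fun n hn => by simp [hn]]
    simp
  have hlim : Tendsto (fun y : ℝ => ∑' n, c (n + M) * y ^ n) (𝓝[Set.Ioo 0 (1 / 2)] 0)
      (𝓝 0) := by
    refine tendsto_const_nhds.congr' ?_
    filter_upwards [self_mem_nhdsWithin] with y hy
    exact (hshift y ⟨hy.1, hy.2.trans (by norm_num)⟩).tsum_eq.symm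
  have : (𝓝[Set.Ioo (0 : ℝ) (1 / 2)] 0).NeBot := by
    rw [nhdsWithin_Ioo_eq_nhdsGT (by norm_num)]
    infer_instance
  exact hM (hval ▸ tendsto_nhds_unique h0 hlim)

/-- The renewal theorem for an aperiodic step distribution with finite mean; `g k` is the mass
of a step of length `k + 1`. -/
theorem renewal_tendsto {g u : ℕ → ℝ} {μ : ℝ} (hg : ∀ k, 0 ≤ g k) (hg1 : HasSum g 1)
    (hg0 : 0 < g 0) (hu : ∀ n, 0 ≤ u n)
    (hrec : ∀ n, u (n + 1) = ∑ k ∈ Finset.range (n + 1), g k * u (n - k))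
    (hμ : HasSum (tailSum g) μ) :
    Tendsto u atTop (𝓝 (u 0 / μ)) := by
  have hbd : ∀ n, u n ≤ u 0 := by
    intro n
    induction n using Nat.strong_induction_on with
    | _ n ih =>
      rcases n with _ | n
      · exact le_rfl
      · rw [hrec]
        calc ∑ k ∈ Finset.range (n + 1), g k * u (n - k)
            ≤ ∑ k ∈ Finset.range (n + 1), g k * u 0 :=
              Finset.sum_le_sum fun k _ => mul_le_mul_of_nonneg_left (ih _ (by omega)) (hg k)
          _ = (∑ k ∈ Finset.range (n + 1), g k) * u 0 := (Finset.sum_mul ..).symm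
          _ ≤ 1 * u 0 := mul_le_mul_of_nonneg_right
              (sum_le_hasSum _ (fun k _ => hg k) hg1) (hu 0)
          _ = u 0 := one_mul _
  have hT0 : tailSum g 0 = 1 := hg1.tsum_eq
  have hTu : ∀ n, ∑ k ∈ Finset.range (n + 1), tailSum g k * u (n - k) = u 0 := by
    intro n
    induction n with
    | zero => simp [hT0]
    | succ n ih =>
      rw [Finset.sum_range_succ', hT0, Nat.sub_zero, hrec]
      simp only [tailSum_succ hg1.summable, sub_mul, Nat.add_sub_add_right,
        Finset.sum_sub_distrib, ih]
      ring
  have hdom : ∀ (U : Ultrafilter ℕ), (U : Filter ℕ) ≤ atTop → ∀ (w : ℕ → ℝ) (a : ℕ → ℝ),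
      (∀ k, 0 ≤ w k) → Summable w → (∀ k, Tendsto (fun n => u (n - k)) U (𝓝 (a k))) →
      Tendsto (fun n => ∑ k ∈ Finset.range (n + 1), w k * u (n - k)) U
        (𝓝 (∑' k, w k * a k)) := by
    intro U hU w a hw hws ha
    have h := tendsto_tsum_of_dominated_convergence (𝓕 := (U : Filter ℕ))
      (f := fun n k => if k ∈ Finset.range (n + 1) then w k * u (n - k) else 0)
      (g := fun k => w k * a k) (hws.mul_right (u 0)) (fun k => ?_)
      (Eventually.of_forall fun n k => ?_)
    · refine h.congr fun n => ?_
      rw [tsum_eq_sum (s := Finset.range (n + 1)) fun k hk => if_neg hk]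
      exact Finset.sum_congr rfl fun k hk => if_pos hk
    · refine ((ha k).const_mul (w k)).congr' ?_
      filter_upwards [hU (eventually_ge_atTop k)] with n hn
      rw [if_pos (Finset.mem_range.2 (by omega))]
    · split_ifs
      · rw [Real.norm_of_nonneg (mul_nonneg (hw k) (hu _))]
        exact mul_le_mul_of_nonneg_left (hbd _) (hw k)
      · simpa using mul_nonneg (hw k) (hu 0)
  have hlim : ∀ U : Ultrafilter ℕ, ∃ x ∈ Set.Icc 0 (u 0), Tendsto u U (𝓝 x) := by
    intro U
    obtain ⟨x, hx, hle⟩ := isCompact_Icc.ultrafilter_le_nhds' (U.map u)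
      (Ultrafilter.mem_map.2 (Filter.univ_mem' fun n => ⟨hu n, hbd n⟩))
    exact ⟨x, hx, hle⟩
  have hsub : ∀ k, Tendsto (fun n : ℕ => n - k) atTop atTop := tendsto_sub_atTop_nat
  have hshift : ∀ U : Ultrafilter ℕ, (U : Filter ℕ) ≤ atTop → ∃ a : ℕ → ℝ,
      (∀ k, a k ∈ Set.Icc 0 (u 0)) ∧ (∀ k, Tendsto (fun n => u (n - k)) U (𝓝 (a k))) ∧
      ∀ k, MapClusterPt (a k) atTop u := by
    intro U hU
    choose a ha hta using fun k => hlim (U.map fun n => n - k)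
    refine ⟨a, ha, fun k => hta k, fun k => ?_⟩
    exact mapClusterPt_iff_ultrafilter.2 ⟨U.map fun n => n - k, (hsub k).mono_left hU, hta k⟩
  have hcpt : IsCompact {x | MapClusterPt x atTop u} := by
    refine isCompact_Icc.of_isClosed_subset isClosed_setOfPred_clusterPt (s := Set.Icc 0 (u 0)) ?_
    intro x hx
    obtain ⟨U, -, hUx⟩ := mapClusterPt_iff_ultrafilter.1 hx
    exact isClosed_Icc.mem_of_tendsto hUx (Eventually.of_forall fun n : ℕ => ⟨hu n, hbd n⟩)
  have hne : {x | MapClusterPt x atTop u}.Nonempty := by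
    obtain ⟨a, -, -, ha⟩ := hshift (Ultrafilter.of atTop) (Ultrafilter.of_le _)
    exact ⟨a 0, ha 0⟩
  obtain ⟨L, hL, hmax⟩ := hcpt.exists_isGreatest hne
  have hTs := hμ.summable
  have hTnn := tailSum_nonneg hg
  have hTlim : ∀ (U : Ultrafilter ℕ), (U : Filter ℕ) ≤ atTop → ∀ a : ℕ → ℝ,
      (∀ k, Tendsto (fun n => u (n - k)) U (𝓝 (a k))) → ∑' k, tailSum g k * a k = u 0 := by
    intro U hU a hta
    have h := hdom U hU _ a hTnn hTs hta
    simp only [hTu] at h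
    exact (tendsto_nhds_unique h tendsto_const_nhds)
  have hstep : ∀ U : Ultrafilter ℕ, (U : Filter ℕ) ≤ atTop → Tendsto u U (𝓝 L) →
      Tendsto (fun n => u (n - 1)) U (𝓝 L) := by
    intro U hU hUL
    obtain ⟨a, ha, hta, hcl⟩ := hshift (U.map fun n => n - 1) ((hsub 1).mono_left hU)
    have h := hdom (U.map fun n => n - 1) ((hsub 1).mono_left hU) g a hg hg1.summable hta
    have h' : Tendsto u U (𝓝 (∑' k, g k * a k)) := by
      refine (tendsto_map'_iff.1 h).congr' ?_
      filter_upwards [hU (eventually_ge_atTop 1)] with n hn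
      obtain ⟨m, rfl⟩ := Nat.exists_eq_add_of_le' hn
      simp [hrec]
    have hL' : ∑' k, g k * a k = L := tendsto_nhds_unique h' hUL
    have hga : Summable fun k => g k * a k :=
      Summable.of_nonneg_of_le (fun k => mul_nonneg (hg k) (ha k).1)
        (fun k => mul_le_mul_of_nonneg_left (ha k).2 (hg k)) (hg1.summable.mul_right (u 0))
    have hzero : HasSum (fun k => g k * (L - a k)) 0 := by
      have := (hg1.mul_right L).sub hga.hasSum
      rw [hL', one_mul, sub_self] at this
      simpa only [mul_sub] using this
    have hz := (hasSum_zero_iff_of_nonneg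
      fun k => mul_nonneg (hg k) (sub_nonneg.2 (hmax (hcl k)))).1 hzero
    have : a 0 = L := by
      have := congrFun hz 0
      simp only [Pi.zero_apply, mul_eq_zero, hg0.ne', false_or] at this
      linarith
    have h0 := hta 0
    rw [this] at h0
    exact tendsto_map'_iff.1 h0
  have hLμ : L * μ = u 0 := by
    obtain ⟨U, hU, hUL⟩ := mapClusterPt_iff_ultrafilter.1 hL
    have hall : ∀ k, Tendsto (fun n => u (n - k)) U (𝓝 L) := by
      intro k
      induction k with
      | zero => exact hUL
      | succ k ih =>
        have := hstep (U.map fun n => n - k) ((hsub k).mono_left hU) ih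
        exact (tendsto_map'_iff.1 this).congr fun n => by simp [Nat.sub_sub]
    rw [← hTlim U hU _ hall, tsum_mul_right, hμ.tsum_eq, mul_comm]
  have hμ1 : 1 ≤ μ := hT0 ▸ le_hasSum hμ 0 fun k _ => hTnn k
  have hμ0 : μ ≠ 0 := by positivity
  rw [← hLμ, mul_div_cancel_right₀ _ hμ0]
  refine (tendsto_iff_ultrafilter _ _ _).2 fun U hU => ?_
  obtain ⟨a, ha, hta, hcl⟩ := hshift U hU
  have hTa := hTlim U hU a hta
  have hs : Summable fun k => tailSum g k * a k :=
    Summable.of_nonneg_of_le (fun k => mul_nonneg (hTnn k) (ha k).1)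
      (fun k => mul_le_mul_of_nonneg_left (ha k).2 (hTnn k)) (hTs.mul_right (u 0))
  have hzero : HasSum (fun k => tailSum g k * (L - a k)) 0 := by
    have := (hμ.mul_right L).sub hs.hasSum
    rw [hTa, mul_comm μ, hLμ, sub_self] at this
    simpa only [mul_sub] using this
  have hz := (hasSum_zero_iff_of_nonneg
    fun k => mul_nonneg (hTnn k) (sub_nonneg.2 (hmax (hcl k)))).1 hzero
  have : a 0 = L := by
    have := congrFun hz 0
    simp only [Pi.zero_apply, hT0, one_mul] at this
    linarith
  exact this ▸ hta 0

/-- The coefficients of the solution, as a power series in `z`, of the equation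
`V = z * (α + c * V + b * V ^ 2)`. -/
noncomputable def fixCoeff (α c b : ℝ) : ℕ → ℝ
  | 0 => 0
  | n + 1 => (if n = 0 then α else 0) + c * fixCoeff α c b n +
      b * ∑ k : Fin (n + 1), fixCoeff α c b k * fixCoeff α c b (n - k)

lemma fixCoeff_zero (α c b : ℝ) : fixCoeff α c b 0 = 0 := by
  rw [fixCoeff]

lemma fixCoeff_succ (α c b : ℝ) (n : ℕ) :
    fixCoeff α c b (n + 1) = (if n = 0 then α else 0) + c * fixCoeff α c b n +
      b * ∑ k ∈ Finset.range (n + 1), fixCoeff α c b k * fixCoeff α c b (n - k) := by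
  rw [fixCoeff, Fin.sum_univ_eq_sum_range fun k => fixCoeff α c b k * fixCoeff α c b (n - k)]

lemma fixCoeff_succ_mul_pow (α c b z : ℝ) (n : ℕ) :
    fixCoeff α c b (n + 1) * z ^ (n + 1) = z * ((if n = 0 then α else 0) +
      c * (fixCoeff α c b n * z ^ n) + b * ∑ k ∈ Finset.range (n + 1),
        fixCoeff α c b k * z ^ k * (fixCoeff α c b (n - k) * z ^ (n - k))) := by
  have : ∑ k ∈ Finset.range (n + 1),
      fixCoeff α c b k * z ^ k * (fixCoeff α c b (n - k) * z ^ (n - k)) =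
      (∑ k ∈ Finset.range (n + 1), fixCoeff α c b k * fixCoeff α c b (n - k)) * z ^ n := by
    rw [Finset.sum_mul]
    refine Finset.sum_congr rfl fun k hk => ?_
    have hkn : k + (n - k) = n := by have := Finset.mem_range.1 hk; omega
    rw [← hkn, pow_add, hkn]
    ring
  rw [this, fixCoeff_succ]
  rcases n with _ | n
  · simp; ring
  · simp; ring

lemma tsum_fixCoeff_eq {α c b z : ℝ}
    (hs : Summable fun n => fixCoeff α c b n * z ^ n) :
    ∑' n, fixCoeff α c b n * z ^ n =
      z * (α + c * ∑' n, fixCoeff α c b n * z ^ n +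
        b * (∑' n, fixCoeff α c b n * z ^ n) ^ 2) := by
  have hnorm : Summable fun n => ‖fixCoeff α c b n * z ^ n‖ := hs.norm
  have hprod := (summable_norm_sum_mul_range_of_summable_norm hnorm hnorm).of_norm.hasSum
  rw [← tsum_mul_tsum_eq_tsum_sum_range_of_summable_norm hnorm hnorm, ← sq] at hprod
  have hα' : HasSum (fun n : ℕ => if n = 0 then α else 0) α := hasSum_ite_eq 0 α
  have h := ((hα'.add (hs.hasSum.mul_left c)).add (hprod.mul_left b)).mul_left z
  refine HasSum.tsum_eq ?_
  rw [← hasSum_nat_add_iff' 1]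
  simp only [Finset.sum_range_one, fixCoeff_zero, zero_mul, sub_zero]
  simpa only [fixCoeff_succ_mul_pow] using h

section fixCoeff

variable {α c b : ℝ} (hα : 0 ≤ α) (hc : 0 ≤ c) (hb : 0 ≤ b)
include hα hc hb

lemma fixCoeff_nonneg (n : ℕ) : 0 ≤ fixCoeff α c b n := by
  induction n using Nat.strong_induction_on with
  | _ n ih =>
    rcases n with _ | n
    · rw [fixCoeff_zero]
    · rw [fixCoeff_succ]
      have h1 : 0 ≤ ∑ k ∈ Finset.range (n + 1), fixCoeff α c b k * fixCoeff α c b (n - k) :=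
        Finset.sum_nonneg fun k hk =>
          mul_nonneg (ih k (Finset.mem_range.1 hk)) (ih (n - k) (by omega))
      have h2 := ih n (by omega)
      have h3 : 0 ≤ if n = 0 then α else 0 := by split_ifs <;> simp [hα]
      positivity

lemma sum_fixCoeff_le {z x : ℝ} (hz : 0 ≤ z) (hx : 0 ≤ x)
    (hfix : z * (α + c * x + b * x ^ 2) ≤ x) (N : ℕ) :
    ∑ n ∈ Finset.range N, fixCoeff α c b n * z ^ n ≤ x := by
  have hv := fixCoeff_nonneg hα hc hb
  induction N with
  | zero => simpa using hx
  | succ N ih =>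
    set S := ∑ n ∈ Finset.range N, fixCoeff α c b n * z ^ n with hS
    have hS0 : 0 ≤ S := Finset.sum_nonneg fun n _ => mul_nonneg (hv n) (by positivity)
    have hconv : ∑ n ∈ Finset.range N, ∑ k ∈ Finset.range (n + 1),
        fixCoeff α c b k * z ^ k * (fixCoeff α c b (n - k) * z ^ (n - k)) ≤ S ^ 2 := by
      rw [Finset.sum_range_diag_flip N
        (fun k l => fixCoeff α c b k * z ^ k * (fixCoeff α c b l * z ^ l)), sq, hS,
        Finset.sum_mul_sum]
      refine Finset.sum_le_sum fun k _ => Finset.sum_le_sum_of_subset_of_nonneg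
        (Finset.range_mono (Nat.sub_le _ _)) fun l _ _ => ?_
      have := hv k
      have := hv l
      positivity
    have hα' : ∑ n ∈ Finset.range N, (if n = 0 then α else 0) ≤ α := by
      rw [Finset.sum_ite_eq' (Finset.range N) 0 fun _ => α]
      split_ifs <;> simp [hα]
    calc ∑ n ∈ Finset.range (N + 1), fixCoeff α c b n * z ^ n
        = z * ((∑ n ∈ Finset.range N, (if n = 0 then α else 0)) + c * S +
          b * ∑ n ∈ Finset.range N, ∑ k ∈ Finset.range (n + 1),
            fixCoeff α c b k * z ^ k * (fixCoeff α c b (n - k) * z ^ (n - k))) := by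
          rw [Finset.sum_range_succ', fixCoeff_zero, zero_mul, add_zero, hS, Finset.mul_sum,
            Finset.mul_sum, ← Finset.sum_add_distrib, ← Finset.sum_add_distrib, Finset.mul_sum]
          exact Finset.sum_congr rfl fun n _ => fixCoeff_succ_mul_pow ..
      _ ≤ z * (α + c * x + b * x ^ 2) := by
          gcongr
          exact hconv.trans (pow_le_pow_left₀ hS0 ih 2)
      _ ≤ x := hfix

lemma summable_fixCoeff {z x : ℝ} (hz : 0 ≤ z) (hx : 0 ≤ x)
    (hfix : z * (α + c * x + b * x ^ 2) ≤ x) :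
    Summable fun n => fixCoeff α c b n * z ^ n :=
  summable_of_sum_range_le
    (fun n => mul_nonneg (fixCoeff_nonneg hα hc hb n) (by positivity))
    (sum_fixCoeff_le hα hc hb hz hx hfix)

lemma tsum_fixCoeff_le {z x : ℝ} (hz : 0 ≤ z) (hx : 0 ≤ x)
    (hfix : z * (α + c * x + b * x ^ 2) ≤ x) :
    ∑' n, fixCoeff α c b n * z ^ n ≤ x :=
  Real.tsum_le_of_sum_range_le
    (fun n => mul_nonneg (fixCoeff_nonneg hα hc hb n) (by positivity))
    (sum_fixCoeff_le hα hc hb hz hx hfix)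

end fixCoeff

/-- The generating function of `fixCoeff` is the smaller root of the quadratic equation. -/
lemma tsum_fixCoeff_mul_eq {α c b z : ℝ} (hα : 0 < α) (hc : 0 ≤ c) (hb : 0 < b) (hz : 0 < z)
    (hs : Summable fun n => fixCoeff α c b n * z ^ n) :
    z * (b * ∑' n, fixCoeff α c b n * z ^ n) =
      (1 - c * z - √((1 - c * z) ^ 2 - 4 * (α * b) * z ^ 2)) / 2 := by
  have hV0 : 0 ≤ ∑' n, fixCoeff α c b n * z ^ n :=
    tsum_nonneg fun n => mul_nonneg (fixCoeff_nonneg hα.le hc hb.le n) (by positivity)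
  have heq := tsum_fixCoeff_eq hs
  have hle := fun x hx h => tsum_fixCoeff_le hα.le hc hb.le hz.le (x := x) hx h
  set V := ∑' n, fixCoeff α c b n * z ^ n
  have hV : 0 < V := by rw [heq]; positivity
  have hle' : V ≤ α / (b * V) := by
    refine hle _ (by positivity) (le_of_eq ?_)
    field_simp
    linear_combination (-1 : ℝ) * heq
  have hVV : b * V ^ 2 ≤ α := by
    rw [le_div_iff₀ (by positivity)] at hle'
    linarith
  have hR : 0 ≤ 1 - c * z - 2 * b * z * V := by
    have : V * (1 - c * z - 2 * b * z * V) = z * (α - b * V ^ 2) := by linear_combination heq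
    have h0 : 0 ≤ V * (1 - c * z - 2 * b * z * V) := by
      rw [this]
      exact mul_nonneg hz.le (sub_nonneg.2 hVV)
    exact nonneg_of_mul_nonneg_right h0 hV
  have hsq : (1 - c * z) ^ 2 - 4 * (α * b) * z ^ 2 = (1 - c * z - 2 * b * z * V) ^ 2 := by
    linear_combination (4 * b * z) * heq
  rw [hsq, Real.sqrt_sq hR]
  ring

/-- The boundary level process of the queue has a renewal kernel with nonnegative masses, whose
generating function is explicit up to the branch point. -/
lemma exists_renewal_kernel {α c b e q d w : ℝ} (hα : 0 < α) (hc : 0 < c) (hb : 0 < b)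
    (hsum : α + c + b = 1) (hαb : α < b) (he : 0 < e) (hq : 0 < q) (hq1 : q < 1) (hd : 0 < d)
    (hw : 0 ≤ w) (hw2 : w ^ 2 = α * b) :
    ∃ f : ℕ → ℝ, (∀ k, 0 ≤ f k) ∧ 0 < f 0 ∧ ∀ y, 0 ≤ y → (c + 2 * w) * (q * y + 1 - q) ≤ 1 →
      y ≠ 1 → HasSum (fun k => f k * y ^ k)
        ((e + α - (q * y + 1 - q) * e - (1 - c * (q * y + 1 - q) -
          √((1 - c * (q * y + 1 - q)) ^ 2 - 4 * (α * b) * (q * y + 1 - q) ^ 2)) / 2) /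
          (d * (1 - y))) := by
  have hcw : c + 2 * w < 1 := by nlinarith [sq_pos_of_pos (sub_pos.2 hαb)]
  have hcw0 : 0 < c + 2 * w := by linarith
  set v := fixCoeff α c b with hv
  have hv0 : ∀ n, 0 ≤ v n := fixCoeff_nonneg hα.le hc.le hb.le
  set Z := 1 / (c + 2 * w) with hZ
  have hZ1 : 1 ≤ Z := by rw [hZ, le_div_iff₀ hcw0]; linarith
  have hsZ : Summable fun n => v n * Z ^ n := by
    refine summable_fixCoeff hα.le hc.le hb.le (x := w / b) (by positivity) (by positivity)
      (le_of_eq ?_)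
    rw [hZ]
    field_simp
    linear_combination (-1 : ℝ) * hw2
  have hsz : ∀ z, 0 ≤ z → z ≤ Z → Summable fun n => v n * z ^ n := fun z h0 h1 =>
    Summable.of_nonneg_of_le (fun n => mul_nonneg (hv0 n) (by positivity))
      (fun n => mul_le_mul_of_nonneg_left (pow_le_pow_left₀ h0 h1 n) (hv0 n)) hsZ
  set g : ℕ → ℝ := fun n => (if n = 0 then e else 0) + b * v n with hg
  have hg0 : ∀ n, 0 ≤ g n := fun n =>
    add_nonneg (by split_ifs <;> simp [he.le]) (mul_nonneg hb.le (hv0 n))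
  have hgz : ∀ z, 0 ≤ z → z ≤ Z →
      HasSum (fun n => g n * z ^ n) (e + b * ∑' n, v n * z ^ n) := by
    intro z h0 h1
    have h := (hasSum_ite_eq (0 : ℕ) e).add ((hsz z h0 h1).hasSum.mul_left b)
    convert h using 2 with n
    rcases n with _ | n <;> simp [hg]; ring
  have hg1 : HasSum g (e + α) := by
    have h := hgz 1 zero_le_one hZ1
    have hV := tsum_fixCoeff_mul_eq hα hc.le hb one_pos (hsz 1 zero_le_one hZ1)
    have hsq : (1 - c * 1) ^ 2 - 4 * (α * b) * 1 ^ 2 = (b - α) ^ 2 := by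
      rw [show c = 1 - α - b by linarith]; ring
    rw [hsq, Real.sqrt_sq (sub_pos.2 hαb).le, one_mul] at hV
    rw [hV] at h
    convert h using 1
    · simp
    · linear_combination (1 / 2 : ℝ) * hsum
  have htail : ∀ z, 0 ≤ z → z ≤ Z → z ≠ 1 → HasSum (fun k => tailSum g k * z ^ k)
      ((z * (e + b * ∑' n, v n * z ^ n) - (e + α)) / (z - 1)) := fun z h0 h1 h2 =>
    hasSum_tailSum_mul_pow hg0 hZ1 (hgz Z (by positivity) le_rfl).summable hg1 h0 h1 h2
      (hgz z h0 h1)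
  have ht0 := tailSum_nonneg hg0
  have ht : 0 ≤ 1 - q := by linarith
  have hterm : ∀ m k, 0 ≤ tailSum g k * (q ^ m * (1 - q) ^ (k - m) * k.choose m) := fun m k =>
    mul_nonneg (ht0 k) (by positivity)
  refine ⟨fun m => q / d * ∑' k, tailSum g k * (q ^ m * (1 - q) ^ (k - m) * k.choose m),
    fun m => mul_nonneg (by positivity) (tsum_nonneg (hterm m)), ?_, ?_⟩
  · refine mul_pos (by positivity) (Summable.tsum_pos ?_ (hterm 0) 0 ?_)
    · simpa using (htail (1 - q) ht (by linarith) (by linarith)).summable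
    · simp only [tailSum_zero, hg1.tsum_eq]
      simp
      positivity
  · intro y hy hyZ hy1
    have hz0 : 0 < q * y + (1 - q) := by
      have : 0 ≤ q * y := by positivity
      linarith
    have hzZ : q * y + (1 - q) ≤ Z := by
      rw [hZ, le_div_iff₀ hcw0]
      linarith
    have hz1 : q * y + (1 - q) ≠ 1 := fun h => hy1 (by
      have : q * (y - 1) = 0 := by linarith
      rcases mul_eq_zero.1 this with h | h <;> linarith)
    have h := (hasSum_binomial_expand ht0 hq.le ht hy
      (htail _ hz0.le hzZ hz1)).mul_left (q / d)
    rw [mul_add, tsum_fixCoeff_mul_eq hα hc.le hb hz0 (hsz _ hz0.le hzZ)] at h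
    rw [add_sub_assoc (q * y)]
    have hy1' : y - 1 ≠ 0 := sub_ne_zero.2 hy1
    have hy1'' : 1 - y ≠ 0 := sub_ne_zero.2 hy1.symm
    have hzz : q * y + (1 - q) - 1 = - (q * (1 - y)) := by ring
    rw [hzz] at h
    simp only [mul_assoc] at h ⊢
    convert h using 1
    · rfl
    · field_simp
      ring

/-- A bounded solution of a linear three-term recurrence is geometric when the second
characteristic root exceeds one. -/
lemma geometric_of_bounded {G : ℕ → ℝ} {A x x' C : ℝ} (hx' : 1 < x')
    (hG : ∀ i, |G i| ≤ C) (hA : A ≠ 0)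
    (hrec : ∀ i, A * (G (i + 2) - (x + x') * G (i + 1) + x * x' * G i) = 0) (i : ℕ) :
    G (i + 1) = x * G i := by
  have hD : ∀ i, G (i + 2) - x * G (i + 1) = x' * (G (i + 1) - x * G i) := by
    intro i
    have := (mul_eq_zero.1 (hrec i)).resolve_left hA
    linarith
  have hpow : ∀ n, G (i + n + 1) - x * G (i + n) = x' ^ n * (G (i + 1) - x * G i) := by
    intro n
    induction n with
    | zero => simp
    | succ n ih =>
      have := hD (i + n)
      rw [ih] at this
      rw [show i + (n + 1) + 1 = i + n + 2 by ring, show i + (n + 1) = i + n + 1 by ring, this]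
      ring
  have hbd : ∀ n, x' ^ n * |G (i + 1) - x * G i| ≤ C + |x| * C := by
    intro n
    rw [← abs_of_pos (pow_pos (zero_lt_one.trans hx') n), ← abs_mul, ← hpow]
    refine (abs_sub _ _).trans (add_le_add (hG _) ?_)
    rw [abs_mul]
    exact mul_le_mul_of_nonneg_left (hG _) (abs_nonneg _)
  by_contra hne
  have hpos : 0 < |G (i + 1) - x * G i| := abs_pos.2 (sub_ne_zero.2 hne)
  obtain ⟨n, hn⟩ := pow_unbounded_of_one_lt ((C + |x| * C) / |G (i + 1) - x * G i|) hx'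
  rw [div_lt_iff₀ hpos] at hn
  exact absurd (hbd n) (not_le.2 hn)

namespace BalanceEquations

variable {p q mh ml : ℝ} {pi : ℕ → ℕ → ℝ} {y : ℝ} {G : ℕ → ℝ}

/-- The balance equations off the boundary, in terms of the generating functions of the rows. -/
lemma rowGenFun_rec (h : BalanceEquations p q mh ml pi)
    (hG : ∀ i, HasSum (fun j => pi i j * y ^ j) (G i)) (i : ℕ) :
    G (i + 1) = (q * y + 1 - q) * (p * (1 - mh) * G i +
      (p * mh + (1 - p) * (1 - mh)) * G (i + 1) + (1 - p) * mh * G (i + 2)) := by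
  obtain ⟨-, h0, -, h1⟩ := h
  have e0 := h0 (i + 1) (by omega)
  have hs : ∀ i, HasSum (fun j => pi i (j + 1) * y ^ (j + 1)) (G i - pi i 0) := fun i => by
    simpa using (hasSum_nat_add_iff' 1).2 (hG i)
  have hm : ∀ i, HasSum (fun j => pi i j * y ^ (j + 1)) (y * G i) := fun i => by
    simpa only [pow_succ', mul_left_comm] using (hG i).mul_left y
  have hL := (hs (i + 1)).mul_left (1 - ((1-p)*(1-q)*(1-mh) + p*(1-q)*mh))
  have hR := (((((hs i).mul_left (p*(1-q)*(1-mh))).add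
    ((hs (i + 2)).mul_left ((1-p)*(1-q)*mh))).add
    ((hm (i + 2)).mul_left ((1-p)*q*mh))).add
    ((hm (i + 1)).mul_left (p*q*mh + (1-p)*q*(1-mh)))).add
    ((hm i).mul_left (p*q*(1-mh)))
  have heq := hL.unique <| by
    convert hR using 2 with j
    have := h1 (i + 1) (j + 1) (by omega) (by omega)
    simp only [Nat.add_sub_cancel] at this
    linear_combination y ^ (j + 1) * this
  simp only [Nat.add_sub_cancel] at e0
  linear_combination heq + e0

/-- The balance equations on the boundary, in terms of the generating functions of the rows. -/
lemma boundaryGenFun_eq (h : BalanceEquations p q mh ml pi)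
    (hG : ∀ i, HasSum (fun j => pi i j * y ^ j) (G i)) :
    y * G 0 = (q * y + 1 - q) * (p * mh * y * G 0 + (1 - p) * mh * y * G 1 +
      (1 - p) * (ml + (1 - ml) * y) * G 0) + (1 - p) * (1 - q) * ml * (y - 1) * pi 0 0 := by
  obtain ⟨e0, -, h1, -⟩ := h
  have hs : ∀ i, HasSum (fun j => pi i (j + 1) * y ^ (j + 2)) (y * (G i - pi i 0)) := fun i => by
    have := ((hasSum_nat_add_iff' 1).2 (hG i)).mul_left y
    simpa [pow_succ', mul_left_comm] using this
  have hm : ∀ i, HasSum (fun j => pi i j * y ^ (j + 2)) (y ^ 2 * G i) := fun i => by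
    simpa only [add_comm _ 2, pow_add, mul_left_comm] using (hG i).mul_left (y ^ 2)
  have ht : HasSum (fun j => pi 0 (j + 2) * y ^ (j + 2)) (G 0 - (pi 0 0 + pi 0 1 * y)) := by
    simpa [Finset.sum_range_succ] using (hasSum_nat_add_iff' 2).2 (hG 0)
  have hL := (hs 0).mul_left (1 - ((1-p)*(1-q)*(1-ml) + p*(1-q)*mh + (1-p)*q*ml))
  have hR := ((((hm 0).mul_left (p*q*mh + (1-p)*q*(1-ml))).add
    (ht.mul_left ((1-p)*(1-q)*ml))).add
    ((hm 1).mul_left ((1-p)*q*mh))).add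
    ((hs 1).mul_left ((1-p)*(1-q)*mh))
  have heq := hL.unique <| by
    convert hR using 2 with j
    have := h1 (j + 1) (by omega)
    simp only [Nat.add_sub_cancel] at this
    linear_combination y ^ (j + 2) * this
  linear_combination heq + y * e0

end BalanceEquations

/-- A generating function identity `U * (1 - y * Ψ) = u 0` gives a renewal recursion. -/
lemma renewal_rec_of_genFun {f u : ℕ → ℝ}
    (h : ∀ y ∈ Set.Ioo (0 : ℝ) 1, ∃ Ψ U, HasSum (fun k => f k * y ^ k) Ψ ∧
      HasSum (fun n => u n * y ^ n) U ∧ U * (1 - y * Ψ) = u 0) (n : ℕ) :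
    u (n + 1) = ∑ k ∈ Finset.range (n + 1), f k * u (n - k) := by
  have hz : (fun n => u (n + 1) - ∑ k ∈ Finset.range (n + 1), f k * u (n - k)) = 0 := by
    refine coeff_eq_zero_of_hasSum_zero fun y hy => ?_
    obtain ⟨Ψ, U, hΨ, hU, heq⟩ := h y hy
    have h1 : HasSum (fun n => u (n + 1) * y ^ n) (U * Ψ) := by
      have h2 := ((hasSum_nat_add_iff' 1).2 hU).mul_right y⁻¹
      have hy0 := hy.1.ne'
      simp only [pow_succ, ← mul_assoc, mul_inv_cancel_right₀ hy0] at h2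
      convert h2 using 1
      · rfl
      simp only [Finset.sum_range_one, pow_zero, mul_one]
      field_simp
      linear_combination -heq
    have hprod := (summable_norm_sum_mul_range_of_summable_norm hΨ.summable.norm
      hU.summable.norm).of_norm.hasSum
    rw [← tsum_mul_tsum_eq_tsum_sum_range_of_summable_norm hΨ.summable.norm hU.summable.norm,
      hΨ.tsum_eq, hU.tsum_eq] at hprod
    have h3 := h1.sub hprod
    rw [mul_comm U, sub_self] at h3
    refine (congrArg (fun F => HasSum F (0 : ℝ)) (funext fun n => ?_)).mpr h3
    rw [sub_mul, Finset.sum_mul]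
    congr 1
    refine Finset.sum_congr rfl fun k hk => ?_
    have hkn : k + (n - k) = n := by have := Finset.mem_range.1 hk; omega
    rw [← hkn, pow_add, hkn]
    ring
  exact sub_eq_zero.1 (congrFun hz n)

/-- Exact geometric decay of a renewal sequence: if the generating function
`y * Ψ y` of the steps takes the value one at `r`, inside its interval of convergence, then
`u n * r ^ n` converges. -/
lemma renewal_tendsto_of_pole {f u : ℕ → ℝ} {Ψ : ℝ → ℝ} {ρ r R m : ℝ} (hf : ∀ k, 0 ≤ f k)
    (hf0 : 0 < f 0) (hu : ∀ n, 0 ≤ u n)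
    (hrec : ∀ n, u (n + 1) = ∑ k ∈ Finset.range (n + 1), f k * u (n - k))
    (hρ : 0 ≤ ρ) (hρr : ρ < r) (hrR : r < R)
    (hΨ : ∀ y ∈ Set.Ioc ρ R, HasSum (fun k => f k * y ^ k) (Ψ y)) (hr : r * Ψ r = 1)
    (hm : Tendsto (fun y => (1 - y * Ψ y) / (1 - y / r)) (𝓝[<] r) (𝓝 m)) :
    Tendsto (fun n => u n * r ^ n) atTop (𝓝 (u 0 / m)) := by
  have hr0 : 0 < r := hρ.trans_lt hρr
  set g : ℕ → ℝ := fun k => f k * r ^ (k + 1)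
  have hg : ∀ k, 0 ≤ g k := fun k => mul_nonneg (hf k) (by positivity)
  have hgz : ∀ y ∈ Set.Ioc ρ R, HasSum (fun k => g k * (y / r) ^ k) (r * Ψ y) := by
    intro y hy
    have h := (hΨ y hy).mul_left r
    refine (congrArg (fun F => HasSum F (r * Ψ y)) (funext fun k => ?_)).mpr h
    simp only [g, div_pow]
    field_simp
    ring
  have hg1 : HasSum g 1 := by
    have := hgz r ⟨hρr, hrR.le⟩
    simpa [div_self hr0.ne', hr] using this
  have hRr : 1 < R / r := (one_lt_div hr0).2 hrR
  have hR : R ∈ Set.Ioc ρ R := ⟨hρr.trans hrR, le_rfl⟩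
  have htail : ∀ y ∈ Set.Ioc ρ R, y ≠ r → HasSum (fun k => tailSum g k * (y / r) ^ k)
      ((1 - y * Ψ y) / (1 - y / r)) := by
    intro y hy hyr
    have hne : y / r ≠ 1 := fun h => hyr ((div_eq_one_iff_eq hr0.ne').1 h)
    have h := hasSum_tailSum_mul_pow hg hRr.le (hgz R hR).summable hg1
      (div_nonneg (hρ.trans hy.1.le) hr0.le) (div_le_div_of_nonneg_right hy.2 hr0.le) hne
      (hgz y hy)
    have hval : (y / r * (r * Ψ y) - 1) / (y / r - 1) = (1 - y * Ψ y) / (1 - y / r) := by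
      rw [← mul_assoc, div_mul_cancel₀ _ hr0.ne', ← neg_div_neg_eq, neg_sub, neg_sub]
    rwa [hval] at h
  have hTR := (htail R hR hrR.ne').summable
  have hT0 := tailSum_nonneg hg
  have hbound : ∀ k, ∀ z ∈ Set.Icc 0 (R / r),
      ‖tailSum g k * z ^ k‖ ≤ tailSum g k * (R / r) ^ k := by
    intro k z hz
    rw [Real.norm_of_nonneg (mul_nonneg (hT0 k) (pow_nonneg hz.1 k))]
    exact mul_le_mul_of_nonneg_left (pow_le_pow_left₀ hz.1 hz.2 k) (hT0 k)
  have hT1 : Summable (tailSum g) := by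
    have := Summable.of_norm_bounded hTR fun k => hbound k 1 ⟨zero_le_one, hRr.le⟩
    simpa using this
  have hcont : ContinuousOn (fun z : ℝ => ∑' k, tailSum g k * z ^ k) (Set.Icc 0 (R / r)) :=
    continuousOn_tsum (fun k => by fun_prop) hTR hbound
  have hlim : Tendsto (fun y => ∑' k, tailSum g k * (y / r) ^ k) (𝓝[<] r)
      (𝓝 (∑' k, tailSum g k)) := by
    have h1 := (hcont.continuousAt (Icc_mem_nhds zero_lt_one hRr)).tendsto
    simp only [one_pow, mul_one] at h1
    have h2 : Tendsto (fun y => y / r) (𝓝[<] r) (𝓝 1) := by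
      have : ContinuousAt (fun y => y / r) r := by fun_prop
      have := this.tendsto.mono_left (nhdsWithin_le_nhds (s := Set.Iio r))
      rwa [div_self hr0.ne'] at this
    exact h1.comp h2
  have hμ : ∑' k, tailSum g k = m := by
    refine tendsto_nhds_unique hlim (hm.congr' ?_)
    filter_upwards [Ioo_mem_nhdsLT hρr] with y hy
    exact ((htail y ⟨hy.1, hy.2.le.trans hrR.le⟩ hy.2.ne).tsum_eq).symm
  have hmain := renewal_tendsto (u := fun n => u n * r ^ n) (g := g) hg hg1
    (mul_pos hf0 (by positivity)) (fun n => mul_nonneg (hu n) (by positivity)) (fun n => ?_)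
    (hμ ▸ hT1.hasSum)
  · simpa using hmain
  · rw [hrec, Finset.sum_mul]
    refine Finset.sum_congr rfl fun k hk => ?_
    have hkn : n + 1 = (k + 1) + (n - k) := by have := Finset.mem_range.1 hk; omega
    rw [hkn, pow_add]
    simp only [g]
    ring

namespace BalanceEquations

variable {p q mh ml : ℝ} {pi : ℕ → ℕ → ℝ}

/-- Below one, the generating functions of the rows decay geometrically in the row index. -/
lemma rowGenFun_geometric (h : BalanceEquations p q mh ml pi) (hnn : ∀ i j, 0 ≤ pi i j)
    (hsum : HasSum (fun ij : ℕ × ℕ => pi ij.1 ij.2) 1) (hp : p ∈ Set.Ioo (0 : ℝ) 1)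
    (hq : q ∈ Set.Ioo (0 : ℝ) 1) (hmh : mh ∈ Set.Ioo (0 : ℝ) 1)
    {y : ℝ} (hy : y ∈ Set.Ioo (0 : ℝ) 1) {c : ℝ} (hc : c = p * mh + (1 - p) * (1 - mh)) :
    ∃ G : ℕ → ℝ, (∀ i, HasSum (fun j => pi i j * y ^ j) (G i)) ∧
      ∀ i, 2 * ((1 - p) * mh) * (q * y + 1 - q) * G (i + 1) = (1 - c * (q * y + 1 - q) -
        √((1 - c * (q * y + 1 - q)) ^ 2 -
          4 * (p * (1 - mh) * ((1 - p) * mh)) * (q * y + 1 - q) ^ 2)) * G i := by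
  obtain ⟨hp0, hp1⟩ := hp
  obtain ⟨hq0, hq1⟩ := hq
  obtain ⟨hm0, hm1⟩ := hmh
  obtain ⟨hy0, hy1⟩ := hy
  have hrow : ∀ i, Summable fun j => pi i j := fun i => hsum.summable.prod_factor i
  have htot := hsum.prod_fiberwise fun i => (hrow i).hasSum
  have hle : ∀ i j, pi i j * y ^ j ≤ pi i j := fun i j =>
    mul_le_of_le_one_right (hnn i j) (pow_le_one₀ hy0.le hy1.le)
  have hnn' : ∀ i j, 0 ≤ pi i j * y ^ j := fun i j => mul_nonneg (hnn i j) (by positivity)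
  have hrowy : ∀ i, Summable fun j => pi i j * y ^ j := fun i =>
    Summable.of_nonneg_of_le (hnn' i) (hle i) (hrow i)
  refine ⟨fun i => ∑' j, pi i j * y ^ j, fun i => (hrowy i).hasSum, ?_⟩
  have hG := h.rowGenFun_rec fun i => (hrowy i).hasSum
  set G : ℕ → ℝ := fun i => ∑' j, pi i j * y ^ j
  have hG1 : ∀ i, |G i| ≤ 1 := by
    intro i
    rw [abs_of_nonneg (tsum_nonneg (hnn' i))]
    exact ((hrowy i).tsum_le_tsum (hle i) (hrow i)).trans
      (le_hasSum htot i fun k _ => tsum_nonneg (hnn k))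
  have hz0 : 0 < q * y + 1 - q := by nlinarith
  have hz1 : q * y + 1 - q < 1 := by nlinarith
  set z := q * y + 1 - q
  set b := (1 - p) * mh with hb
  set α := p * (1 - mh) with hα
  have hb0 : 0 < b := mul_pos (by linarith) hm0
  have hα0 : 0 < α := mul_pos hp0 (by linarith)
  have hcs : c = 1 - α - b := by rw [hc, hα, hb]; ring
  have hD : 0 ≤ (1 - c * z) ^ 2 - 4 * (α * b) * z ^ 2 := by
    have h1 : 2 * (α + b) * z ≤ 2 * (1 - c * z) - 0 := by rw [hcs]; nlinarith
    have h2 : (α + b) * z ≤ 1 - c * z := by linarith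
    have h3 : ((α + b) * z) ^ 2 ≤ (1 - c * z) ^ 2 := pow_le_pow_left₀ (by positivity) h2 2
    nlinarith [mul_nonneg (sq_nonneg (α - b)) (sq_nonneg z)]
  have hS := Real.sq_sqrt hD
  have hS0 := Real.sqrt_nonneg ((1 - c * z) ^ 2 - 4 * (α * b) * z ^ 2)
  set S := √((1 - c * z) ^ 2 - 4 * (α * b) * z ^ 2)
  have hbz : 0 < 2 * b * z := by positivity
  have hx' : 1 < (1 - c * z + S) / (2 * b * z) := by
    rw [lt_div_iff₀ hbz]
    by_contra! hle
    have h1 : S ≤ 2 * b * z - (1 - c * z) := by linarith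
    have h2 : S ^ 2 ≤ (2 * b * z - (1 - c * z)) ^ 2 := pow_le_pow_left₀ hS0 h1 2
    have h3 : 0 < b * z * (1 - z) := mul_pos (mul_pos hb0 hz0) (by linarith)
    have h4 : (2 * b * z - (1 - c * z)) ^ 2 - S ^ 2 = -(4 * (b * z * (1 - z))) := by
      rw [hS, hcs]; ring
    linarith
  intro i
  have hgeo := geometric_of_bounded (x := (1 - c * z - S) / (2 * b * z)) hx' hG1
    (A := b * z) (by positivity) (fun i => ?_) i
  · rw [hgeo]
    field_simp
  · have := hG i
    rw [← hc] at this
    have hsumr : (1 - c * z - S) / (2 * b * z) + (1 - c * z + S) / (2 * b * z) =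
        (1 - c * z) / (b * z) := by field_simp; ring
    have hprodr : (1 - c * z - S) / (2 * b * z) * ((1 - c * z + S) / (2 * b * z)) = α / b := by
      field_simp
      linear_combination -hS
    rw [hsumr, hprodr]
    field_simp
    linear_combination -this

/-- The boundary probabilities of the queue solve a renewal recursion with nonnegative masses,
whose generating function is explicit up to the branch point. -/
lemma exists_boundary_renewal (h : BalanceEquations p q mh ml pi) (hnn : ∀ i j, 0 ≤ pi i j)
    (hsum : HasSum (fun ij : ℕ × ℕ => pi ij.1 ij.2) 1) (hp : p ∈ Set.Ioo (0 : ℝ) 1)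
    (hq : q ∈ Set.Ioo (0 : ℝ) 1) (hmh : mh ∈ Set.Ioo (0 : ℝ) 1) (hml : ml ∈ Set.Ioo (0 : ℝ) 1)
    (hpm : p < mh) {c w : ℝ} (hc : c = p * mh + (1 - p) * (1 - mh)) (hw : 0 ≤ w)
    (hw2 : w ^ 2 = p * (1 - mh) * ((1 - p) * mh)) :
    ∃ (f : ℕ → ℝ) (Ψ : ℝ → ℝ), (∀ k, 0 ≤ f k) ∧ 0 < f 0 ∧ 0 < pi 0 0 ∧
      (∀ n, pi 0 (n + 1) = ∑ k ∈ Finset.range (n + 1), f k * pi 0 (n - k)) ∧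
      ∀ y, 0 ≤ y → (c + 2 * w) * (q * y + 1 - q) ≤ 1 → y ≠ 1 →
        HasSum (fun k => f k * y ^ k) (Ψ y) ∧
        2 * ((1 - p) * (1 - q) * ml) * (1 - y) * (1 - y * Ψ y) =
          ((1 - p) + mh - 2 * (1 - p) * ml) * y * (q * y + 1 - q) - y +
            2 * (1 - p) * ml * (q * y + 1 - q) -
          y * √((1 - c * (q * y + 1 - q)) ^ 2 -
            4 * (p * (1 - mh) * ((1 - p) * mh)) * (q * y + 1 - q) ^ 2) := by
  have hgeo := fun y hy => h.rowGenFun_geometric hnn hsum hp hq hmh (y := y) hy hc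
  obtain ⟨hp0, hp1⟩ := hp
  obtain ⟨hq0, hq1⟩ := hq
  obtain ⟨hm0, hm1⟩ := hmh
  obtain ⟨hl0, hl1⟩ := hml
  have hs : 0 < 1 - p := by linarith
  have ht : 0 < 1 - q := by linarith
  have hm' : 0 < 1 - mh := by linarith
  have hl' : 0 < 1 - ml := by linarith
  have hd : 0 < (1 - p) * (1 - q) * ml := by positivity
  have hα : 0 < p * (1 - mh) := by positivity
  have hb : 0 < (1 - p) * mh := by positivity
  have hc0 : 0 < c := by rw [hc]; positivity
  have hcab : p * (1 - mh) + c + (1 - p) * mh = 1 := by rw [hc]; ring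
  have hαb : p * (1 - mh) < (1 - p) * mh := by nlinarith
  have he : 0 < p * mh + (1 - p) * (1 - ml) := by positivity
  obtain ⟨f, hf, hf0, hfΨ⟩ := exists_renewal_kernel hα hc0 hb hcab hαb he hq0 hq1 hd hw hw2
  set Ψ : ℝ → ℝ := fun y => (p * mh + (1 - p) * (1 - ml) + p * (1 - mh) -
    (q * y + 1 - q) * (p * mh + (1 - p) * (1 - ml)) - (1 - c * (q * y + 1 - q) -
      √((1 - c * (q * y + 1 - q)) ^ 2 -
        4 * (p * (1 - mh) * ((1 - p) * mh)) * (q * y + 1 - q) ^ 2)) / 2) /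
    ((1 - p) * (1 - q) * ml * (1 - y))
  have hΨeq : ∀ y, y ≠ 1 → 2 * ((1 - p) * (1 - q) * ml) * (1 - y) * (1 - y * Ψ y) =
      ((1 - p) + mh - 2 * (1 - p) * ml) * y * (q * y + 1 - q) - y +
        2 * (1 - p) * ml * (q * y + 1 - q) -
      y * √((1 - c * (q * y + 1 - q)) ^ 2 -
        4 * (p * (1 - mh) * ((1 - p) * mh)) * (q * y + 1 - q) ^ 2) := by
    intro y hy1
    have hy1' : (1 - p) * (1 - q) * ml * (1 - y) ≠ 0 := mul_ne_zero hd.ne' (sub_ne_zero.2 hy1.symm)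
    have h1 : Ψ y * ((1 - p) * (1 - q) * ml * (1 - y)) = p * mh + (1 - p) * (1 - ml) +
        p * (1 - mh) - (q * y + 1 - q) * (p * mh + (1 - p) * (1 - ml)) -
        (1 - c * (q * y + 1 - q) - √((1 - c * (q * y + 1 - q)) ^ 2 -
          4 * (p * (1 - mh) * ((1 - p) * mh)) * (q * y + 1 - q) ^ 2)) / 2 :=
      div_mul_cancel₀ _ hy1'
    linear_combination (-2 * y) * h1 - (y * (q * y + 1 - q)) * hc
  have hcw : c + 2 * w ≤ 1 := by nlinarith [sq_pos_of_pos (sub_pos.2 hαb)]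
  have hdom : ∀ y ∈ Set.Ioo (0 : ℝ) 1, (c + 2 * w) * (q * y + 1 - q) ≤ 1 := by
    intro y hy
    have : q * y + 1 - q ≤ 1 := by nlinarith [hy.2]
    have h0 : 0 ≤ q * y + 1 - q := by nlinarith [hy.1]
    exact mul_le_one₀ hcw h0 this
  have hrec : ∀ n, pi 0 (n + 1) = ∑ k ∈ Finset.range (n + 1), f k * pi 0 (n - k) := by
    refine renewal_rec_of_genFun fun y hy => ?_
    obtain ⟨G, hG, hGx⟩ := hgeo y hy
    refine ⟨Ψ y, G 0, hfΨ y hy.1.le (hdom y hy) hy.2.ne, hG 0, ?_⟩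
    have h1 := h.boundaryGenFun_eq hG
    have h2 := hGx 0
    have h3 := hΨeq y hy.2.ne
    have h4 : 2 * ((1 - p) * (1 - q) * ml) * (1 - y) ≠ 0 :=
      mul_ne_zero (by positivity) (sub_ne_zero.2 hy.2.ne')
    refine mul_left_cancel₀ h4 ?_
    simp only [zero_add] at h2
    linear_combination G 0 * h3 - 2 * h1 - y * h2 + y * G 0 * (q * y + 1 - q) * hc
  refine ⟨f, Ψ, hf, hf0, (hnn 0 0).lt_of_ne' fun h00 => ?_, hrec,
    fun y hy hyw hy1 => ⟨hfΨ y hy hyw hy1, hΨeq y hy1⟩⟩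
  have hcol : ∀ n, pi 0 n = 0 := by
    intro n
    induction n using Nat.strong_induction_on with
    | _ n ih =>
      rcases n with _ | n
      · exact h00
      · rw [hrec]
        exact Finset.sum_eq_zero fun k _ => by rw [ih (n - k) (by omega), mul_zero]
  obtain ⟨G, hG, hGx⟩ := hgeo (1 / 2) ⟨by norm_num, by norm_num⟩
  have hG0 : ∀ i, G i = 0 := by
    intro i
    induction i with
    | zero => exact (hG 0).unique (by simp [hcol, hasSum_zero])
    | succ i ih =>
      have := hGx i
      rw [ih, mul_zero] at this
      have hne : 2 * ((1 - p) * mh) * (q * (1 / 2) + 1 - q) ≠ 0 := by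
        have : 0 < q * (1 / 2) + 1 - q := by linarith
        positivity
      exact (mul_eq_zero.1 this).resolve_left hne
  have hpi : ∀ i j, pi i j = 0 := by
    intro i j
    have h1 := hG i
    rw [hG0] at h1
    have h2 := congrFun ((hasSum_zero_iff_of_nonneg
      fun j => mul_nonneg (hnn i j) (by positivity)).1 h1) j
    simpa using h2
  have h0 : HasSum (fun ij : ℕ × ℕ => pi ij.1 ij.2) 0 := by
    simp only [hpi]
    exact hasSum_zero
  exact one_ne_zero (hsum.unique h0)

end BalanceEquations

/-- The roots of `d * x ^ 2 = A * x + P / (4 * d)`, given by the quadratic formula, have opposite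
signs. -/
lemma quadratic_formula_facts {A P d x₁ x₂ : ℝ} (hd : 0 < d) (hP : 0 < P)
    (hx₁ : x₁ = (A + √(A ^ 2 + P)) / (2 * d)) (hx₂ : x₂ = (A - √(A ^ 2 + P)) / (2 * d)) :
    d * (x₁ + x₂) = A ∧ 4 * d ^ 2 * (x₁ * x₂) = -P ∧ 0 < x₁ ∧ x₂ < 0 := by
  have hS : √(A ^ 2 + P) ^ 2 = A ^ 2 + P := Real.sq_sqrt (by positivity)
  have habs : |A| < √(A ^ 2 + P) := by
    rw [← Real.sqrt_sq_eq_abs]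
    exact Real.sqrt_lt_sqrt (sq_nonneg A) (by linarith)
  obtain ⟨h₁, h₂⟩ := abs_lt.1 habs
  generalize √(A ^ 2 + P) = S at *
  have e₁ : x₁ * (2 * d) = A + S := by rw [hx₁, div_mul_cancel₀ _ (by positivity)]
  have e₂ : x₂ * (2 * d) = A - S := by rw [hx₂, div_mul_cancel₀ _ (by positivity)]
  refine ⟨by linear_combination (e₁ + e₂) / 2, ?_, ?_, ?_⟩
  · linear_combination x₂ * (2 * d) * e₁ + (A + S) * e₂ - hS
  · rw [hx₁]
    exact div_pos (by linarith) (by positivity)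
  · rw [hx₂]
    exact div_neg_of_neg_of_pos (by linarith) (by positivity)

/-- Let `F` and `D` be such that `F ^ 2 - y ^ 2 * D` factors with a simple zero at `r > 1`. If `F` is
positive at a zero `y₀ > 1` of `D`, and `D` is positive on `(1, y₀)`, then `r` lies in `(1, y₀)` and
`F r = r * √(D r)` is positive. -/
lemma zero_lt_branch_point {F D E : ℝ → ℝ} {η r y₀ : ℝ} (hFcont : Continuous F)
    (hη : 0 < η) (hηr : η * r = 1) (hr1 : 1 < r) (hy₀ : 1 < y₀) (hD0 : D y₀ = 0)
    (hDpos : ∀ y, 1 < y → y < y₀ → 0 < D y) (hE : ∀ y, 1 < y → 0 < E y)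
    (hkey : ∀ y, F y ^ 2 - y ^ 2 * D y = E y * (1 - y) * (1 - η * y)) (hFy₀ : 0 < F y₀) :
    r < y₀ ∧ 0 < F r ∧ r * √(D r) = F r := by
  have hr0 : 0 < r := one_pos.trans hr1
  have hry₀ : r < y₀ := by
    have h1 := hkey y₀
    rw [hD0, mul_zero, sub_zero] at h1
    have h4 : 1 < η * y₀ := by
      by_contra! hle
      nlinarith [mul_nonneg (mul_pos (hE y₀ hy₀) (sub_pos.2 hy₀)).le (sub_nonneg.2 hle),
        sq_pos_of_pos hFy₀]
    rw [← hηr] at h4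
    exact lt_of_mul_lt_mul_left h4 hη.le
  have hFr : 0 < F r := by
    by_contra! hle
    obtain ⟨z, hz, hFz⟩ := intermediate_value_Icc hry₀.le hFcont.continuousOn ⟨hle, hFy₀.le⟩
    have hzy : z < y₀ := hz.2.lt_of_ne fun h => by rw [h] at hFz; exact hFy₀.ne' hFz
    have hz1 : 1 < z := hr1.trans_le hz.1
    have h1 : 0 ≤ η * z - 1 := by
      rw [← hηr, sub_nonneg]
      exact mul_le_mul_of_nonneg_left hz.1 hη.le
    have h2 := mul_pos (pow_pos (hr0.trans_le hz.1) 2) (hDpos z hz1 hzy)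
    have h3 := mul_nonneg (mul_pos (hE z hz1) (sub_pos.2 hz1)).le h1
    have h4 := hkey z
    rw [hFz] at h4
    linarith
  refine ⟨hry₀, hFr, ?_⟩
  have h1 := hkey r
  rw [hηr, sub_self, mul_zero, sub_eq_zero] at h1
  rw [← Real.sqrt_sq hFr.le, h1, Real.sqrt_mul (sq_nonneg r), Real.sqrt_sq hr0.le]

/-- A renewal sequence whose step generating function has a square root singularity at `y₀`, written
through `F`, `D` and the factorization of `F ^ 2 - y ^ 2 * D`, decays geometrically when `F` is
positive at `y₀`. -/
lemma renewal_tendsto_of_sqrt_kernel {f u : ℕ → ℝ} {Ψ F D E : ℝ → ℝ} {d η r y₀ : ℝ}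
    (hf : ∀ k, 0 ≤ f k) (hf0 : 0 < f 0) (hu : ∀ n, 0 ≤ u n)
    (hrec : ∀ n, u (n + 1) = ∑ k ∈ Finset.range (n + 1), f k * u (n - k))
    (hFcont : Continuous F) (hDcont : Continuous D) (hEcont : Continuous E)
    (hη : 0 < η) (hηr : η * r = 1) (hr1 : 1 < r) (hy₀ : 1 < y₀) (hD0 : D y₀ = 0)
    (hDpos : ∀ y, 1 < y → y < y₀ → 0 < D y) (hE : ∀ y, 1 < y → 0 < E y)
    (hkey : ∀ y, F y ^ 2 - y ^ 2 * D y = E y * (1 - y) * (1 - η * y)) (hFy₀ : 0 < F y₀)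
    (hd : 0 < d) (hΨ : ∀ y ∈ Set.Ioc 1 y₀, HasSum (fun k => f k * y ^ k) (Ψ y) ∧
      2 * d * (1 - y) * (1 - y * Ψ y) = F y - y * √(D y)) :
    0 < F r ∧ Tendsto (fun n => u n / η ^ n) atTop (𝓝 (4 * d * u 0 * F r / E r)) := by
  obtain ⟨hry₀, hFr, hsqrt⟩ :=
    zero_lt_branch_point hFcont hη hηr hr1 hy₀ hD0 hDpos hE hkey hFy₀
  refine ⟨hFr, ?_⟩
  have hr0 : 0 < r := one_pos.trans hr1
  have hη' : η = 1 / r := by field_simp; exact hηr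
  have hGcont : Continuous fun y => F y + y * √(D y) := by fun_prop
  have hGr : F r + r * √(D r) = 2 * F r := by rw [hsqrt]; ring
  have hGr0 : 0 < F r + r * √(D r) := by linarith
  have hlim : Tendsto (fun y => (1 - y * Ψ y) / (1 - y / r)) (𝓝[<] r)
      (𝓝 (E r / (2 * d * (F r + r * √(D r))))) := by
    have hcont : ContinuousAt (fun y => E y / (2 * d * (F y + y * √(D y)))) r :=
      ContinuousAt.div (by fun_prop) (by fun_prop) (by positivity)
    refine (hcont.tendsto.mono_left nhdsWithin_le_nhds).congr' ?_
    filter_upwards [self_mem_nhdsWithin, nhdsWithin_le_nhds (lt_mem_nhds hr1),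
      nhdsWithin_le_nhds (hGcont.continuousAt.eventually (lt_mem_nhds hGr0))] with y hyr hy1 hG
    have hyr' : y < r := hyr
    have h1 := (hΨ y ⟨hy1, (hyr'.trans hry₀).le⟩).2
    have h2 := hkey y
    have h3 : 0 < 1 - y / r := sub_pos.2 ((div_lt_one hr0).2 hyr')
    have h4 : 1 - η * y = 1 - y / r := by rw [hη']; ring
    have h5 := Real.sq_sqrt (hDpos y hy1 (hyr'.trans hry₀)).le
    rw [h4] at h2
    rw [div_eq_div_iff (by positivity) h3.ne']
    refine mul_left_cancel₀ (sub_ne_zero.2 hy1.ne) ?_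
    linear_combination (-(F y + y * √(D y))) * h1 - h2 + y ^ 2 * h5
  have hpole : r * Ψ r = 1 := by
    have h1 := (hΨ r ⟨hr1, hry₀.le⟩).2
    rw [hsqrt, sub_self] at h1
    have h2 : 2 * d * (1 - r) ≠ 0 := mul_ne_zero (mul_pos two_pos hd).ne' (sub_ne_zero.2 hr1.ne)
    linarith [(mul_eq_zero.1 h1).resolve_left h2]
  have hmain := renewal_tendsto_of_pole hf hf0 hu hrec zero_le_one hr1 hry₀
    (fun y hy => (hΨ y hy).1) hpole hlim
  have hval : u 0 / (E r / (2 * d * (F r + r * √(D r)))) = 4 * d * u 0 * F r / E r := by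
    rw [hGr, div_div_eq_mul_div]
    ring
  rw [hval] at hmain
  refine hmain.congr fun n => ?_
  rw [hη', one_div, inv_pow, div_inv_eq_mul]

/-- For `0 < C' < C < 1`, the zero `y₀` of `1 - C * (q * y + 1 - q)` exceeds one, and the function
`(1 - C * (q * y + 1 - q)) * (1 - C' * (q * y + 1 - q))` is positive on `(1, y₀)`. -/
lemma branch_point_facts {C C' q y₀ : ℝ} (hq : 0 < q) (hC' : 0 < C') (hCC' : C' < C) (hC1 : C < 1)
    (hy₀ : y₀ = C' / (C * C' * q) - (1 - q) / q) :
    C * (q * y₀ + 1 - q) = 1 ∧ 1 < y₀ ∧ (∀ y ≤ y₀, C * (q * y + 1 - q) ≤ 1) ∧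
      ∀ y, 1 < y → y < y₀ → 0 < (1 - C * (q * y + 1 - q)) * (1 - C' * (q * y + 1 - q)) := by
  have hC : 0 < C := hC'.trans hCC'
  have h1 : y₀ * q = C⁻¹ - (1 - q) := by
    rw [hy₀, sub_mul, div_mul_cancel₀ _ hq.ne', ← div_div, div_mul_cancel₀ _ hq.ne',
      mul_comm C, div_mul_cancel_left₀ hC'.ne']
  have h2 : q * y₀ + 1 - q = C⁻¹ := by linarith
  have h3 : C * (q * y₀ + 1 - q) = 1 := by rw [h2, mul_inv_cancel₀ hC.ne']
  refine ⟨h3, ?_, fun y hy => ?_, fun y hy hyy => ?_⟩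
  · have h4 : 1 < C⁻¹ := (one_lt_inv₀ hC).2 hC1
    have h5 : 0 < q * (y₀ - 1) := by linarith
    linarith [pos_of_mul_pos_right h5 hq.le]
  · refine le_trans ?_ h3.le
    gcongr
  · have h4 : C * (q * y + 1 - q) < 1 := by
      refine lt_of_lt_of_eq ?_ h3
      gcongr
    have h5 : 0 < q * (y - 1) := mul_pos hq (sub_pos.2 hy)
    have h6 : C' * (q * y + 1 - q) < C * (q * y + 1 - q) :=
      mul_lt_mul_of_pos_right hCC' (by linarith)
    exact mul_pos (by linarith) (by linarith)

/-- The two numbers `eta_1` and `eta_2` of the priority queue. -/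
lemma eta_facts {p q mh ml eta1 eta2 : ℝ} (hp : p ∈ Set.Ioo (0 : ℝ) 1)
    (hq : q ∈ Set.Ioo (0 : ℝ) 1) (hml : ml ∈ Set.Ioo (0 : ℝ) 1) (hpar : p + q + mh + ml = 1)
    (hload : p * ml + q * mh < mh * ml) (hmu : ml ≤ mh)
    (heta1 : eta1 = ((1 - mh*(1-q) - (1-p)*(1-q)*(1-ml) - (1-p)*q*ml)
        + Real.sqrt ((1 - mh*(1-q) - (1-p)*(1-q)*(1-ml) - (1-p)*q*ml)^2
            + 4*(1-p)*(1-q)*(mh - (1-p)*ml)*(1-ml)*q))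
        / (2*(1-p)*(1-q)*ml))
    (heta2 : eta2 = ((1 - mh*(1-q) - (1-p)*(1-q)*(1-ml) - (1-p)*q*ml)
        - Real.sqrt ((1 - mh*(1-q) - (1-p)*(1-q)*(1-ml) - (1-p)*q*ml)^2
            + 4*(1-p)*(1-q)*(mh - (1-p)*ml)*(1-ml)*q))
        / (2*(1-p)*(1-q)*ml)) :
    (1 - p) * (1 - q) * ml * (eta1 + eta2) =
        1 - mh * (1 - q) - (1 - p) * (1 - q) * (1 - ml) - (1 - p) * q * ml ∧
      (1 - p) * (1 - q) * ml ^ 2 * (eta1 * eta2) = -(q * (1 - ml) * (mh - (1 - p) * ml)) ∧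
      0 < eta1 ∧ eta2 < 0 ∧ eta1 < 1 := by
  obtain ⟨hp0, hp1⟩ := hp
  obtain ⟨hq0, hq1⟩ := hq
  obtain ⟨hl0, hl1⟩ := hml
  have hs : 0 < 1 - p := by linarith
  have ht : 0 < 1 - q := by linarith
  have hl' : 0 < 1 - ml := by linarith
  have hmsl : 0 < mh - (1 - p) * ml := by linarith [mul_pos hp0 hl0]
  have hd2 : 2 * (1 - p) * (1 - q) * ml = 2 * ((1 - p) * (1 - q) * ml) := by ring
  rw [hd2] at heta1 heta2
  obtain ⟨hsum, hmul, h1, h2⟩ := quadratic_formula_facts (by positivity) (by positivity)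
    heta1 heta2
  have hmul' : (1 - p) * (1 - q) * ml ^ 2 * (eta1 * eta2) =
      -(q * (1 - ml) * (mh - (1 - p) * ml)) := by
    have h4 : 4 * ((1 - p) * (1 - q)) ≠ 0 := by positivity
    refine mul_left_cancel₀ h4 ?_
    linear_combination hmul
  refine ⟨hsum, hmul', h1, h2, ?_⟩
  have hprod : (1 - p) * (1 - q) * ml ^ 2 * ((1 - eta1) * (1 - eta2)) =
      mh * ml - p * ml - q * mh := by
    obtain rfl : mh = 1 - p - q - ml := by linarith
    linear_combination hmul' - ml * hsum
  have h3 : 0 < (1 - eta1) * (1 - eta2) := by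
    refine pos_of_mul_pos_right (a := (1 - p) * (1 - q) * ml ^ 2) ?_ (by positivity)
    rw [hprod]
    linarith
  exact sub_pos.1 (pos_of_mul_pos_left h3 (by linarith))

/-- Factorization of `F ^ 2 - y ^ 2 * Delta`. -/
lemma sq_sub_sq_mul_disc_eq {p q mh ml eta1 eta2 : ℝ} (hpar : p + q + mh + ml = 1)
    (hsum : (1 - p) * (1 - q) * ml * (eta1 + eta2) =
      1 - mh * (1 - q) - (1 - p) * (1 - q) * (1 - ml) - (1 - p) * q * ml)
    (hmul : (1 - p) * (1 - q) * ml ^ 2 * (eta1 * eta2) = -(q * (1 - ml) * (mh - (1 - p) * ml)))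
    (y : ℝ) :
    (((1 - p) + mh - 2 * (1 - p) * ml) * y * (q * y + 1 - q) - y +
        2 * (1 - p) * ml * (q * y + 1 - q)) ^ 2 -
      y ^ 2 * ((1 - (p * mh + (1 - p) * (1 - mh)) * (q * y + 1 - q)) ^ 2 -
        4 * (p * (1 - mh) * ((1 - p) * mh)) * (q * y + 1 - q) ^ 2) =
    4 * (1 - p) ^ 2 * (1 - q) * ml ^ 2 * (q * y + 1 - q) * (1 - eta2 * y) * (1 - y) *
      (1 - eta1 * y) := by
  obtain rfl : mh = 1 - p - q - ml := by linarith
  linear_combination 4 * (1 - p) * (q * y + 1 - q) * (1 - y) * (ml * y * hsum - y ^ 2 * hmul)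

/-- exact geometric decay of the boundary probabilities when
`F(y_0) > 0`. -/
theorem tail_boundary_geometric
    (p q mh ml : ℝ)
    (hp : p ∈ Set.Ioo (0:ℝ) 1) (hq : q ∈ Set.Ioo (0:ℝ) 1)
    (hmh : mh ∈ Set.Ioo (0:ℝ) 1) (hml : ml ∈ Set.Ioo (0:ℝ) 1)
    (hpar : p + q + mh + ml = 1)
    (hrho : p / mh + q / ml < 1)
    (hmu : ml ≤ mh)
    (F : ℝ → ℝ)
    (hF : ∀ y, F y = ((1-p) + mh - 2*(1-p)*ml)*q*y^2
        + (((1-p) + mh - 2*(1-p)*ml)*(1-q) + 2*(1-p)*q*ml - 1)*y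
        + 2*(1-p)*(1-q)*ml)
    (y0 y1 : ℝ)
    (hy0 : y0 = (p*mh + (1-p)*(1-mh) - 2*Real.sqrt (p*mh*(1-p)*(1-mh)))
        / ((p*mh - (1-p)*(1-mh))^2 * q) - (1-q)/q)
    (hy1 : y1 = (p*mh + (1-p)*(1-mh) + 2*Real.sqrt (p*mh*(1-p)*(1-mh)))
        / ((p*mh - (1-p)*(1-mh))^2 * q) - (1-q)/q)
    (eta1 eta2 : ℝ)
    (heta1 : eta1 = ((1 - mh*(1-q) - (1-p)*(1-q)*(1-ml) - (1-p)*q*ml)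
        + Real.sqrt ((1 - mh*(1-q) - (1-p)*(1-q)*(1-ml) - (1-p)*q*ml)^2
            + 4*(1-p)*(1-q)*(mh - (1-p)*ml)*(1-ml)*q))
        / (2*(1-p)*(1-q)*ml))
    (heta2 : eta2 = ((1 - mh*(1-q) - (1-p)*(1-q)*(1-ml) - (1-p)*q*ml)
        - Real.sqrt ((1 - mh*(1-q) - (1-p)*(1-q)*(1-ml) - (1-p)*q*ml)^2
            + 4*(1-p)*(1-q)*(mh - (1-p)*ml)*(1-ml)*q))
        / (2*(1-p)*(1-q)*ml))
    (pi : ℕ → ℕ → ℝ)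
    (hnn : ∀ i j : ℕ, 0 ≤ pi i j)
    (hsum : HasSum (fun ij : ℕ × ℕ => pi ij.1 ij.2) 1)
    (hbal : BalanceEquations p q mh ml pi)
    (a b : ℝ)
    (ha : a = (pi 0 0 / (2*(1-p)*ml)) * (eta1 / (eta1 - eta2)))
    (hb : b = (pi 0 0 / (2*(1-p)*ml)) * (eta2 / (eta2 - eta1)))
    (hFy0 : 0 < F y0)
    (Cl1 : ℝ)
    (hCl1 : Cl1 = 2 * a * F (1/eta1) / (q/eta1 + 1 - q)) :
    Filter.Tendsto (fun j : ℕ => pi 0 j / eta1 ^ j) Filter.atTop (nhds Cl1) ∧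
    Cl1 ≠ 0 := by
  obtain ⟨hp0, hp1⟩ := hp
  obtain ⟨hq0, hq1⟩ := hq
  obtain ⟨hm0, hm1⟩ := hmh
  obtain ⟨hl0, hl1⟩ := hml
  have hs : 0 < 1 - p := by linarith
  have ht : 0 < 1 - q := by linarith
  have hm' : 0 < 1 - mh := by linarith
  have hd : 0 < (1 - p) * (1 - q) * ml := by positivity
  have hload : p * ml + q * mh < mh * ml := by
    rwa [div_add_div _ _ hm0.ne' hl0.ne', div_lt_one (by positivity), mul_comm mh q] at hrho
  have hpm : p < mh := by
    refine lt_of_mul_lt_mul_right ?_ hl0.le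
    linarith [mul_pos hq0 hm0]
  obtain ⟨heta_sum, heta_mul, heta1_pos, heta2_neg, heta1_lt⟩ :=
    eta_facts ⟨hp0, hp1⟩ ⟨hq0, hq1⟩ ⟨hl0, hl1⟩ hpar hload hmu heta1 heta2
  clear heta1 heta2
  obtain ⟨c, hc⟩ : ∃ c, c = p * mh + (1 - p) * (1 - mh) := ⟨_, rfl⟩
  obtain ⟨w, hw⟩ : ∃ w, w = √(p * mh * (1 - p) * (1 - mh)) := ⟨_, rfl⟩
  have hw0 : 0 < w := by
    rw [hw]
    positivity
  have hw2 : w ^ 2 = p * (1 - mh) * ((1 - p) * mh) := by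
    rw [hw, Real.sq_sqrt (by positivity)]
    ring
  have hc0 : 0 < c := by
    rw [hc]
    positivity
  have hcw : c + 2 * w < 1 := by
    have h1 : (2 * w) ^ 2 < (1 - c) ^ 2 := by
      have h2 : 0 < (mh - p) ^ 2 := pow_pos (sub_pos.2 hpm) 2
      rw [mul_pow, hw2, hc]
      linarith
    have h2 : 0 ≤ 1 - c := by
      have : 1 - c = p * (1 - mh) + (1 - p) * mh := by
        rw [hc]
        ring
      rw [this]
      positivity
    linarith [lt_of_pow_lt_pow_left₀ 2 h2 h1]
  have hsq : (c + 2 * w) * (c - 2 * w) = (p * mh - (1 - p) * (1 - mh)) ^ 2 := by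
    linear_combination (-4) * hw2 + (c + (p * mh + (1 - p) * (1 - mh))) * hc
  have hcw' : 0 < c - 2 * w := by
    have hne : p * mh - (1 - p) * (1 - mh) ≠ 0 := (by linarith : _ < (0 : ℝ)).ne
    refine pos_of_mul_pos_right (a := c + 2 * w) ?_ (by positivity)
    rw [hsq]
    positivity
  rw [← hsq, ← hc, ← hw] at hy0
  obtain ⟨hy0c, hy0_one, hdom, hpos⟩ :=
    branch_point_facts hq0 hcw' (by linarith) hcw hy0
  clear hy0 hy1
  have hDw : ∀ y, (1 - c * (q * y + 1 - q)) ^ 2 -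
      4 * (p * (1 - mh) * ((1 - p) * mh)) * (q * y + 1 - q) ^ 2 =
      (1 - (c + 2 * w) * (q * y + 1 - q)) * (1 - (c - 2 * w) * (q * y + 1 - q)) := fun y => by
    linear_combination 4 * (q * y + 1 - q) ^ 2 * hw2
  replace hF : ∀ y, F y = ((1 - p) + mh - 2 * (1 - p) * ml) * y * (q * y + 1 - q) - y +
      2 * (1 - p) * ml * (q * y + 1 - q) := fun y => by
    rw [hF]
    ring
  have hFcont : Continuous F := by
    rw [funext hF]
    fun_prop
  obtain ⟨f, Ψ, hf, hf0, hpi0, hrec, hΨ⟩ := hbal.exists_boundary_renewal hnn hsum ⟨hp0, hp1⟩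
    ⟨hq0, hq1⟩ ⟨hm0, hm1⟩ ⟨hl0, hl1⟩ hpm hc hw0.le hw2
  have hr1 : 1 < 1 / eta1 := one_lt_one_div heta1_pos heta1_lt
  have hβ : ∀ y, 1 < y → 0 < q * y + 1 - q := fun y hy => by
    linarith [mul_pos hq0 (sub_pos.2 hy)]
  obtain ⟨hFr, hmain⟩ := renewal_tendsto_of_sqrt_kernel (F := F)
    (D := fun y => (1 - c * (q * y + 1 - q)) ^ 2 -
      4 * (p * (1 - mh) * ((1 - p) * mh)) * (q * y + 1 - q) ^ 2)
    (E := fun y => 4 * (1 - p) ^ 2 * (1 - q) * ml ^ 2 * (q * y + 1 - q) * (1 - eta2 * y))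
    hf hf0 (hnn 0) hrec hFcont (by fun_prop) (by fun_prop) heta1_pos
    (mul_one_div_cancel heta1_pos.ne') hr1 hy0_one
    ((hDw y0).trans (by rw [hy0c, sub_self, zero_mul])) (fun y hy hyy => by
      rw [hDw]
      exact hpos y hy hyy)
    (fun y hy => by
      have h1 := hβ y hy
      have h2 : 0 < 1 - eta2 * y := by linarith [mul_neg_of_neg_of_pos heta2_neg (one_pos.trans hy)]
      positivity)
    (fun y => by
      rw [hF, hc]
      exact sq_sub_sq_mul_disc_eq hpar heta_sum heta_mul y) hFy0 hd
    (fun y hy => by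
      rw [hF]
      exact hΨ y (by linarith [hy.1]) (hdom y hy.2) hy.1.ne')
  have hβr : q * (1 / eta1) + 1 - q = q / eta1 + 1 - q := by ring
  have hβr0 : 0 < q / eta1 + 1 - q := hβr ▸ hβ _ hr1
  have h12 : 0 < eta1 - eta2 := by linarith
  have h2 : 1 - eta2 * (1 / eta1) = (eta1 - eta2) / eta1 := by field_simp
  rw [hβr, h2] at hmain
  rw [hCl1, ha]
  generalize F (1 / eta1) = Fr at *
  generalize q / eta1 + 1 - q = β at *
  refine ⟨?_, by positivity⟩
  convert hmain using 2
  field_simp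
end

section
/- Assume mu_l ≤ mu_h and F(y_0) = 0 (geometric decay with prefactor j^{−1/2}). Then lim_{j→∞} pi_{0,j}·sqrt(j)·y_0^j = C_{l,2}, where C_{l,2} = a·((1−p)−mu_h)·q·y_0·sqrt(y_0·(y_1−y_0))/((q·y_0+1−q)·sqrt(π)) with a = (pi_{0,0}/(2(1−p)·mu_l))·eta_1/(eta_1−eta_2) and π the circle constant, and C_{l,2} ≠ 0. -/
/-- The weighted `ℓ¹` condition `∑ √(n+1) |fₙ| < ∞` on the coefficients of a power series. -/
def SqrtWeightSummable (f : PowerSeries ℝ) : Prop :=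
  Summable fun n : ℕ => √((n : ℝ) + 1) * |PowerSeries.coeff n f|

/-- The power series `f` converges absolutely at `z`, with value `v`. -/
def EvaluatesTo (f : PowerSeries ℝ) (z v : ℝ) : Prop :=
  (Summable fun n : ℕ => ‖PowerSeries.coeff n f * z ^ n‖) ∧
    HasSum (fun n : ℕ => PowerSeries.coeff n f * z ^ n) v

lemma sqrt_add_add_one_le (k l : ℕ) :
    √(((k + l : ℕ) : ℝ) + 1) ≤ √((k : ℝ) + 1) * √((l : ℝ) + 1) := by
  rw [← Real.sqrt_mul (by positivity)]
  apply Real.sqrt_le_sqrt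
  push_cast
  nlinarith [mul_nonneg (Nat.cast_nonneg (α := ℝ) k) (Nat.cast_nonneg (α := ℝ) l)]

namespace SqrtWeightSummable

variable {f g : PowerSeries ℝ}

lemma mul (hf : SqrtWeightSummable f) (hg : SqrtWeightSummable g) :
    SqrtWeightSummable (f * g) := by
  unfold SqrtWeightSummable at *
  have hf' := hf.norm
  have hg' := hg.norm
  refine (summable_norm_sum_mul_antidiagonal_of_summable_norm hf' hg').of_nonneg_of_le
    (fun n => by positivity) (fun n => ?_)
  rw [PowerSeries.coeff_mul, Real.norm_of_nonneg (Finset.sum_nonneg fun _ _ => by positivity)]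
  refine (mul_le_mul_of_nonneg_left (Finset.abs_sum_le_sum_abs _ _) (by positivity)).trans ?_
  rw [Finset.mul_sum]
  refine Finset.sum_le_sum fun kl hkl => ?_
  rw [← Finset.HasAntidiagonal.mem_antidiagonal.mp hkl, abs_mul]
  calc √(((kl.1 + kl.2 : ℕ) : ℝ) + 1) * (|PowerSeries.coeff kl.1 f| * |PowerSeries.coeff kl.2 g|)
      ≤ (√((kl.1 : ℝ) + 1) * √((kl.2 : ℝ) + 1)) *
          (|PowerSeries.coeff kl.1 f| * |PowerSeries.coeff kl.2 g|) := by
        gcongr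
        exact sqrt_add_add_one_le _ _
    _ = _ := by ring

lemma add (hf : SqrtWeightSummable f) (hg : SqrtWeightSummable g) :
    SqrtWeightSummable (f + g) := by
  refine (Summable.add hf hg).of_nonneg_of_le (fun n => by positivity) (fun n => ?_)
  rw [map_add, ← mul_add]
  gcongr
  exact abs_add_le _ _

lemma of_polynomial (P : Polynomial ℝ) : SqrtWeightSummable (P : PowerSeries ℝ) := by
  refine summable_of_ne_finset_zero (s := P.support) fun n hn => ?_
  simp [Polynomial.notMem_support_iff.mp hn]

lemma tendsto_zero (hf : SqrtWeightSummable f) :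
    Filter.Tendsto (fun n : ℕ => √(n : ℝ) * PowerSeries.coeff n f) Filter.atTop (nhds 0) := by
  refine squeeze_zero_norm (fun n => ?_) (Summable.tendsto_atTop_zero hf)
  rw [norm_mul, Real.norm_of_nonneg (Real.sqrt_nonneg _), Real.norm_eq_abs]
  gcongr
  linarith

/-- Convolving a sequence of order `n^{-1/2}` with a `√(n+1)`-summable sequence multiplies the
leading constant by the sum of the latter. -/
lemma tendsto_coeff_mul (hf : SqrtWeightSummable f) {S L : ℝ}
    (hS : EvaluatesTo f 1 S)
    (hb : ∀ n : ℕ, √((n : ℝ) + 1) * |PowerSeries.coeff n g| ≤ 1)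
    (hL : Filter.Tendsto (fun n : ℕ => √(n : ℝ) * PowerSeries.coeff n g) Filter.atTop (nhds L)) :
    Filter.Tendsto (fun n : ℕ => √(n : ℝ) * PowerSeries.coeff n (f * g)) Filter.atTop
      (nhds (S * L)) := by
  have hSL : HasSum (fun k : ℕ => PowerSeries.coeff k f * L) (S * L) := by
    simpa using hS.2.mul_right L
  rw [← hSL.tsum_eq]
  let u : ℕ → ℕ → ℝ := fun n k =>
    if k ≤ n then √(n : ℝ) * (PowerSeries.coeff k f * PowerSeries.coeff (n - k) g) else 0
  have hu : (fun n : ℕ => √(n : ℝ) * PowerSeries.coeff n (f * g)) = fun n => ∑' k, u n k := by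
    funext n
    rw [PowerSeries.coeff_mul, Finset.Nat.sum_antidiagonal_eq_sum_range_succ_mk,
      tsum_eq_sum (s := Finset.range (n + 1))
        (fun k hk => if_neg (by simpa using hk)), Finset.mul_sum]
    exact Finset.sum_congr rfl fun k hk =>
      (if_pos (Nat.lt_succ_iff.mp (Finset.mem_range.mp hk))).symm
  rw [hu]
  refine tendsto_tsum_of_dominated_convergence hf (fun k => ?_)
    (Filter.Eventually.of_forall fun n k => ?_)
  · have h1 : Filter.Tendsto (fun m : ℕ => √((m + k : ℕ) : ℝ) / √(m : ℝ)) Filter.atTop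
        (nhds 1) := by
      have h2 : Filter.Tendsto (fun m : ℕ => √(1 + (k : ℝ) / (m : ℝ))) Filter.atTop
          (nhds (√(1 + 0))) :=
        (Real.continuous_sqrt.tendsto _).comp
          (tendsto_const_nhds.add (tendsto_const_div_atTop_nhds_zero_nat _))
      rw [add_zero, Real.sqrt_one] at h2
      refine h2.congr' ?_
      filter_upwards [Filter.eventually_gt_atTop 0] with m hm
      have : (m : ℝ) ≠ 0 := by positivity
      rw [← Real.sqrt_div (by positivity)]
      congr 1
      push_cast
      field_simp
    rw [← Filter.tendsto_add_atTop_iff_nat k]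
    have h3 := (h1.mul hL).const_mul (PowerSeries.coeff k f)
    rw [one_mul] at h3
    refine h3.congr' ?_
    filter_upwards [Filter.eventually_gt_atTop 0] with m hm
    have : √(m : ℝ) ≠ 0 := by positivity
    simp only [u, if_pos (Nat.le_add_left k m), Nat.add_sub_cancel]
    field_simp
  · by_cases hk : k ≤ n
    · obtain ⟨m, rfl⟩ := Nat.exists_eq_add_of_le hk
      simp only [u, if_pos hk, Nat.add_sub_cancel_left]
      rw [norm_mul, norm_mul, Real.norm_of_nonneg (Real.sqrt_nonneg _), Real.norm_eq_abs,
        Real.norm_eq_abs]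
      calc √((k + m : ℕ) : ℝ) * (|PowerSeries.coeff k f| * |PowerSeries.coeff m g|)
          ≤ (√((k : ℝ) + 1) * √((m : ℝ) + 1)) *
              (|PowerSeries.coeff k f| * |PowerSeries.coeff m g|) := by
            gcongr
            exact (Real.sqrt_le_sqrt (by linarith)).trans (sqrt_add_add_one_le k m)
        _ = (√((k : ℝ) + 1) * |PowerSeries.coeff k f|) *
              (√((m : ℝ) + 1) * |PowerSeries.coeff m g|) := by ring
        _ ≤ _ := mul_le_of_le_one_right (by positivity) (hb m)
    · simp only [u, if_neg hk, norm_zero]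
      positivity

end SqrtWeightSummable

namespace EvaluatesTo

variable {f g : PowerSeries ℝ} {z v w : ℝ}

lemma add (hf : EvaluatesTo f z v) (hg : EvaluatesTo g z w) : EvaluatesTo (f + g) z (v + w) := by
  refine ⟨(hf.1.add hg.1).of_nonneg_of_le (fun n => norm_nonneg _) fun n => ?_, ?_⟩
  · rw [map_add, add_mul]
    exact norm_add_le _ _
  · simpa [add_mul] using hf.2.add hg.2

lemma mul (hf : EvaluatesTo f z v) (hg : EvaluatesTo g z w) : EvaluatesTo (f * g) z (v * w) := by
  have key : (fun n : ℕ => ∑ kl ∈ Finset.HasAntidiagonal.antidiagonal n,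
      (PowerSeries.coeff kl.1 f * z ^ kl.1) * (PowerSeries.coeff kl.2 g * z ^ kl.2)) =
      fun n : ℕ => PowerSeries.coeff n (f * g) * z ^ n := by
    funext n
    rw [PowerSeries.coeff_mul, Finset.sum_mul]
    refine Finset.sum_congr rfl fun kl hkl => ?_
    rw [← Finset.HasAntidiagonal.mem_antidiagonal.mp hkl, pow_add]
    ring
  have h1 := summable_norm_sum_mul_antidiagonal_of_summable_norm hf.1 hg.1
  have h2 := tsum_mul_tsum_eq_tsum_sum_antidiagonal_of_summable_norm hf.1 hg.1
  simp only [funext_iff] at key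
  simp only [key] at h1 h2
  refine ⟨h1, ?_⟩
  rw [← hf.2.tsum_eq, ← hg.2.tsum_eq, h2]
  exact h1.of_norm.hasSum

lemma C (a : ℝ) : EvaluatesTo (PowerSeries.C a) z a := by
  constructor
  · refine summable_of_ne_finset_zero (s := {0}) fun n hn => ?_
    simp [PowerSeries.coeff_C, Finset.notMem_singleton.mp hn]
  · convert hasSum_single (f := fun n : ℕ => PowerSeries.coeff n (PowerSeries.C a) * z ^ n) 0 ?_
    · simp
    · intro n hn
      simp [PowerSeries.coeff_C, hn]

lemma X : EvaluatesTo PowerSeries.X z z := by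
  constructor
  · refine summable_of_ne_finset_zero (s := {1}) fun n hn => ?_
    simp [PowerSeries.coeff_X, Finset.notMem_singleton.mp hn]
  · convert hasSum_single (f := fun n : ℕ => PowerSeries.coeff n PowerSeries.X * z ^ n) 1 ?_
    · simp
    · intro n hn
      simp [PowerSeries.coeff_X, hn]

/-- Two power series with the same values on an interval `(0, δ)` are equal. -/
lemma eq_of_forall {δ : ℝ} (hδ : 0 < δ)
    (h : ∀ z ∈ Set.Ioo 0 δ, ∃ v, EvaluatesTo f z v ∧ EvaluatesTo g z v) : f = g := by
  rw [← sub_eq_zero]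
  have hz : ∀ z ∈ Set.Ioo 0 δ, EvaluatesTo (f - g) z 0 := by
    intro z hz
    obtain ⟨v, hf, hg⟩ := h z hz
    have := hf.add ((C (-1)).mul hg)
    simpa [sub_eq_add_neg] using this
  generalize f - g = d at hz
  let P : FormalMultilinearSeries ℝ ℝ ℝ :=
    FormalMultilinearSeries.ofScalars ℝ fun n => PowerSeries.coeff n d
  have hr : (((δ / 2).toNNReal : NNReal) : ℝ) = δ / 2 := Real.coe_toNNReal _ (half_pos hδ).le
  have hrad : 0 < P.radius := by
    refine lt_of_lt_of_le ?_ (P.le_radius_of_summable (r := (δ / 2).toNNReal) ?_)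
    · rw [ENNReal.coe_pos, Real.toNNReal_pos]
      exact half_pos hδ
    · refine (hz (δ / 2) ⟨by linarith, by linarith⟩).1.of_nonneg_of_le
        (fun n => by positivity) fun n => ?_
      rw [norm_mul, norm_pow, hr, Real.norm_of_nonneg (half_pos hδ).le]
      refine mul_le_mul_of_nonneg_right ?_ (pow_nonneg (half_pos hδ).le _)
      simp [P]
  have hP := (P.hasFPowerSeriesOnBall hrad).hasFPowerSeriesAt
  have hzero : ∃ᶠ z in nhdsWithin 0 {0}ᶜ, P.sum z = 0 := by
    refine Filter.Frequently.filter_mono ?_ (nhdsGT_le_nhdsNE (0 : ℝ))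
    refine (Filter.Eventually.frequently ?_)
    filter_upwards [Ioo_mem_nhdsGT hδ] with z hz'
    rw [← (hz z hz').2.tsum_eq]
    simp [P, FormalMultilinearSeries.sum, FormalMultilinearSeries.ofScalars]
  have hev := hP.analyticAt.frequently_zero_iff_eventually_zero.mp hzero
  have h0 := hP.eq_zero_of_eventually hev
  ext n
  have : P.coeff n = 0 := by
    rw [h0]
    rfl
  simpa [P] using this

end EvaluatesTo

open Filter Topology in
lemma tendsto_zero_of_add_mul_tendsto_zero {d : ℕ → ℝ} {α M : ℝ} (hα : 0 ≤ α) (hα1 : α ≠ 1)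
    (hM : ∀ᶠ n in atTop, |d n| ≤ M)
    (h : Tendsto (fun n => d (n + 1) + α * d n) atTop (𝓝 0)) : Tendsto d atTop (𝓝 0) := by
  have hbdd : IsBoundedUnder (· ≤ ·) atTop fun n => |d n| := ⟨M, by simpa using hM⟩
  have hcob : IsCoboundedUnder (· ≤ ·) atTop fun n => |d n| :=
    isCoboundedUnder_le_of_le atTop (x := 0) fun n => abs_nonneg _
  set D := limsup (fun n => |d n|) atTop with hD
  have hD0 : 0 ≤ D := le_limsup_of_frequently_le
    (Frequently.of_forall fun n => abs_nonneg (d n)) hbdd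
  have hstep : ∀ e > 0, ∀ᶠ n in atTop, |d n| < D + e ∧ |d (n + 1) + α * d n| < e := by
    intro e he
    have h1 := eventually_lt_of_limsup_lt (show limsup (fun n => |d n|) atTop < D + e by linarith)
    have h2 := (tendsto_order.mp h.abs).2 e (by simpa using he)
    exact h1.and h2
  have hD' : D ≤ 0 := by
    rcases lt_or_gt_of_ne hα1 with hlt | hgt
    · have : D ≤ α * D := by
        refine le_of_forall_pos_le_add fun e he => limsup_le_of_le hcob ?_
        obtain ⟨N, hN⟩ := eventually_atTop.mp (hstep (e / 2) (half_pos he))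
        filter_upwards [eventually_ge_atTop (N + 1)] with n hn
        obtain ⟨m, rfl⟩ := Nat.exists_eq_add_of_le hn
        obtain ⟨h1, h2⟩ := hN (N + m) (Nat.le_add_right _ _)
        have h3 : |d (N + m + 1)| ≤ |d (N + m + 1) + α * d (N + m)| + α * |d (N + m)| := by
          have := abs_sub (d (N + m + 1) + α * d (N + m)) (α * d (N + m))
          rwa [add_sub_cancel_right, abs_mul α, abs_of_nonneg hα] at this
        rw [show N + 1 + m = N + m + 1 by ring]
        nlinarith [abs_nonneg (d (N + m))]
      nlinarith
    · have : α * D ≤ D := by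
        refine le_of_forall_pos_le_add fun e he => ?_
        have hα0 : 0 < α := by linarith
        rw [mul_comm, ← le_div_iff₀ hα0]
        refine limsup_le_of_le hcob ?_
        obtain ⟨N, hN⟩ := eventually_atTop.mp (hstep (e / 2) (half_pos he))
        filter_upwards [eventually_ge_atTop N] with n hn
        have h2 := (hN n hn).2
        have h1 := (hN (n + 1) (by omega)).1
        have h3 : α * |d n| ≤ |d (n + 1) + α * d n| + |d (n + 1)| := by
          have := abs_sub (d (n + 1) + α * d n) (d (n + 1))
          rwa [add_sub_cancel_left, abs_mul α, abs_of_nonneg hα] at this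
        rw [le_div_iff₀ hα0]
        linarith
      nlinarith
  rw [tendsto_zero_iff_abs_tendsto_zero]
  refine tendsto_order.mpr ⟨fun a ha => Eventually.of_forall fun n => ha.trans_le (abs_nonneg _),
    fun a ha => ?_⟩
  filter_upwards [hstep a ha] with n hn
  exact hn.1.trans_le (by simp; linarith)

/-- The coefficients `∏_{i<n} (2i+1)/(2i+2)` of `(1 - X)^{-1/2}`. -/
noncomputable def invSqrtCoeff (n : ℕ) : ℝ :=
  ∏ i ∈ Finset.range n, (2 * (i : ℝ) + 1) / (2 * i + 2)

namespace invSqrtCoeff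

lemma pos (n : ℕ) : 0 < invSqrtCoeff n := Finset.prod_pos fun i _ => by positivity

lemma succ (n : ℕ) :
    invSqrtCoeff (n + 1) = invSqrtCoeff n * ((2 * (n : ℝ) + 1) / (2 * n + 2)) :=
  Finset.prod_range_succ _ _

lemma sq_mul_wallis (n : ℕ) :
    invSqrtCoeff n ^ 2 * ((2 * (n : ℝ) + 1) * Real.Wallis.W n) = 1 := by
  induction n with
  | zero => simp [invSqrtCoeff, Real.Wallis.W]
  | succ n ih =>
    rw [succ, Real.Wallis.W_succ]
    refine Eq.trans ?_ ih
    push_cast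
    field_simp
    ring

lemma sq_mul_le (n : ℕ) : invSqrtCoeff n ^ 2 * ((n : ℝ) + 1) ≤ 1 := by
  induction n with
  | zero => simp [invSqrtCoeff]
  | succ n ih =>
    rw [succ]
    refine le_trans ?_ ih
    have h : ((2 * (n : ℝ) + 1) / (2 * n + 2)) ^ 2 * ((n : ℝ) + 1 + 1) ≤ (n : ℝ) + 1 := by
      rw [div_pow, div_mul_eq_mul_div, div_le_iff₀ (by positivity)]
      have : (0 : ℝ) ≤ n := Nat.cast_nonneg n
      nlinarith [mul_nonneg this this]
    push_cast
    calc _ = invSqrtCoeff n ^ 2 *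
          (((2 * (n : ℝ) + 1) / (2 * n + 2)) ^ 2 * ((n : ℝ) + 1 + 1)) := by ring
      _ ≤ _ := by gcongr

lemma sqrt_mul_le (n : ℕ) : √((n : ℝ) + 1) * invSqrtCoeff n ≤ 1 := by
  have h : (√((n : ℝ) + 1) * invSqrtCoeff n) ^ 2 ≤ 1 := by
    rw [mul_pow, Real.sq_sqrt (by positivity), mul_comm]
    exact sq_mul_le n
  exact (sq_le_one_iff₀ (mul_nonneg (Real.sqrt_nonneg _) (pos n).le)).mp h

lemma le_one (n : ℕ) : invSqrtCoeff n ≤ 1 := by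
  refine le_trans (le_mul_of_one_le_left (pos n).le ?_) (sqrt_mul_le n)
  rw [Real.one_le_sqrt]
  linarith [Nat.cast_nonneg (α := ℝ) n]

open Filter Topology in
lemma tendsto_sqrt_mul :
    Tendsto (fun n : ℕ => √(n : ℝ) * invSqrtCoeff n) atTop (𝓝 (1 / √Real.pi)) := by
  have hW := Real.Wallis.tendsto_W_nhds_pi_div_two
  have h1 : Tendsto (fun n : ℕ => ((2 : ℝ) + 1 / n) * Real.Wallis.W n) atTop
      (𝓝 ((2 + 0) * (Real.pi / 2))) :=
    (tendsto_const_nhds.add tendsto_one_div_atTop_nhds_zero_nat).mul hW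
  have h2 : ((2 : ℝ) + 0) * (Real.pi / 2) = Real.pi := by ring
  rw [h2] at h1
  have h3 := ((Real.continuous_sqrt.tendsto _).comp h1).inv₀ (Real.sqrt_ne_zero'.mpr Real.pi_pos)
  rw [one_div]
  refine h3.congr' ?_
  filter_upwards [eventually_gt_atTop 0] with n hn
  have hn' : (0 : ℝ) < n := by exact_mod_cast hn
  have hWn := Real.Wallis.W_pos n
  have hsq := sq_mul_wallis n
  refine inv_eq_of_mul_eq_one_left ?_
  simp only [Function.comp_apply]
  rw [← pow_eq_one_iff_of_nonneg (mul_nonneg (mul_nonneg (Real.sqrt_nonneg _) (pos n).le)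
    (Real.sqrt_nonneg _)) two_ne_zero]
  rw [mul_pow, mul_pow, Real.sq_sqrt hn'.le, Real.sq_sqrt (by positivity)]
  refine Eq.trans ?_ hsq
  field_simp

/-- The power series of `(1 - X)^{-1/2}`. -/
noncomputable def series : PowerSeries ℝ := PowerSeries.mk invSqrtCoeff

lemma series_sq : series ^ 2 * (1 - PowerSeries.X) = 1 := by
  have hode : 2 * (1 - PowerSeries.X) * PowerSeries.derivative ℝ series = series := by
    ext n
    rw [mul_assoc, show (2 : PowerSeries ℝ) = PowerSeries.C 2 from (map_ofNat _ 2).symm,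
      PowerSeries.coeff_C_mul, sub_mul, one_mul, map_sub]
    cases n with
    | zero => simp [series, PowerSeries.coeff_derivative, succ]; ring
    | succ n =>
      simp only [series, PowerSeries.coeff_derivative, PowerSeries.coeff_succ_X_mul,
        PowerSeries.coeff_mk, succ]
      push_cast
      field_simp
      ring
  refine PowerSeries.derivative.ext (R := ℝ) ?_ ?_
  · simp [Derivation.leibniz, pow_two]
    linear_combination series * hode
  · simp [series, invSqrtCoeff]

lemma evaluatesTo {τ z : ℝ} (hτ : 0 ≤ τ) (hz : 0 ≤ z) (h : τ * z < 1) :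
    EvaluatesTo (PowerSeries.mk fun n => invSqrtCoeff n * τ ^ n) z (1 / √(1 - τ * z)) := by
  have hs : ∀ n, PowerSeries.coeff n (PowerSeries.mk fun n => invSqrtCoeff n * τ ^ n) * z ^ n =
      PowerSeries.coeff n series * (τ * z) ^ n := by
    intro n
    simp [series, mul_pow, mul_assoc]
  suffices hmain : EvaluatesTo series (τ * z) (1 / √(1 - τ * z)) by
    unfold EvaluatesTo at *
    simpa only [hs] using hmain
  have hx : 0 ≤ τ * z := mul_nonneg hτ hz
  generalize τ * z = x at h hx
  have hsum : Summable fun n : ℕ => ‖PowerSeries.coeff n series * x ^ n‖ := by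
    refine (summable_geometric_of_lt_one hx h).of_nonneg_of_le (fun n => norm_nonneg _)
      fun n => ?_
    rw [Real.norm_of_nonneg (by simpa [series] using mul_nonneg (pos n).le (pow_nonneg hx n))]
    simpa [series] using mul_le_of_le_one_left (pow_nonneg hx n) (le_one n)
  have hE : EvaluatesTo series x (∑' n : ℕ, PowerSeries.coeff n series * x ^ n) :=
    ⟨hsum, hsum.of_norm.hasSum⟩
  have hpos : 0 ≤ ∑' n : ℕ, PowerSeries.coeff n series * x ^ n :=
    tsum_nonneg fun n => by simpa [series] using mul_nonneg (pos n).le (pow_nonneg hx n)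
  generalize (∑' n : ℕ, PowerSeries.coeff n series * x ^ n) = g at hE hpos
  have h1 : EvaluatesTo (series * series * (PowerSeries.C 1 + PowerSeries.C (-1) * PowerSeries.X))
      x (g * g * (1 + -1 * x)) :=
    (hE.mul hE).mul ((EvaluatesTo.C 1).add ((EvaluatesTo.C (-1)).mul EvaluatesTo.X))
  have h2 : series * series * (PowerSeries.C 1 + PowerSeries.C (-1) * PowerSeries.X) =
      PowerSeries.C 1 := by
    rw [map_neg, map_one]
    linear_combination series_sq
  rw [h2] at h1
  have h3 := h1.2.unique (EvaluatesTo.C 1).2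
  have h4 : g = 1 / √(1 - x) := by
    rw [eq_div_iff (Real.sqrt_ne_zero'.mpr (by linarith)),
      ← pow_eq_one_iff_of_nonneg (mul_nonneg hpos (Real.sqrt_nonneg _)) two_ne_zero, mul_pow,
      Real.sq_sqrt (by linarith)]
    linarith
  exact h4 ▸ hE

lemma sqrtWeightSummable_sq_mul_series :
    SqrtWeightSummable ((1 - PowerSeries.X) ^ 2 * series) := by
  unfold SqrtWeightSummable
  rw [← summable_nat_add_iff 2]
  have hcoeff : ∀ n : ℕ, PowerSeries.coeff (n + 2) ((1 - PowerSeries.X) ^ 2 * series) =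
      invSqrtCoeff n * (3 / (4 * ((n : ℝ) + 1) * (n + 2))) := by
    intro n
    have h1 : (1 - PowerSeries.X) ^ 2 * series =
        series - 2 * (PowerSeries.X * series) + PowerSeries.X * (PowerSeries.X * series) := by ring
    rw [h1, show (2 : PowerSeries ℝ) = PowerSeries.C 2 from (map_ofNat _ 2).symm, map_add, map_sub,
      PowerSeries.coeff_C_mul]
    simp only [PowerSeries.coeff_succ_X_mul, series, PowerSeries.coeff_mk, succ]
    push_cast
    field_simp
    ring
  have hsum : Summable fun n : ℕ => 3 * (1 / ((n + 1 : ℕ) : ℝ) ^ 2) :=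
    ((summable_nat_add_iff 1).mpr (Real.summable_one_div_nat_pow.mpr one_lt_two)).mul_left 3
  refine hsum.of_nonneg_of_le (fun n => by positivity) fun n => ?_
  rw [hcoeff, abs_of_nonneg (mul_nonneg (pos n).le (by positivity))]
  have h2 : √(((n + 2 : ℕ) : ℝ) + 1) ≤ 2 * √((n : ℝ) + 1) := by
    rw [Real.sqrt_le_left (by positivity), mul_pow, Real.sq_sqrt (by positivity)]
    push_cast
    linarith [Nat.cast_nonneg (α := ℝ) n]
  have hc := (pos n).le
  calc √(((n + 2 : ℕ) : ℝ) + 1) * (invSqrtCoeff n * (3 / (4 * ((n : ℝ) + 1) * (n + 2))))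
      ≤ (2 * √((n : ℝ) + 1)) * (invSqrtCoeff n * (3 / (4 * ((n : ℝ) + 1) * (n + 2)))) := by
        gcongr
    _ = (√((n : ℝ) + 1) * invSqrtCoeff n) * (3 / (2 * ((n : ℝ) + 1) * (n + 2))) := by
        field_simp; ring
    _ ≤ 1 * (3 / (2 * ((n : ℝ) + 1) * (n + 2))) := by
        gcongr
        exact sqrt_mul_le n
    _ ≤ _ := by
        rw [one_mul, mul_one_div]
        push_cast
        gcongr
        nlinarith [Nat.cast_nonneg (α := ℝ) n]

lemma sqrtWeightSummable_geometric {τ : ℝ} (hτ : 0 ≤ τ) (hτ1 : τ < 1) :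
    SqrtWeightSummable (PowerSeries.mk fun n => invSqrtCoeff n * τ ^ n) := by
  refine (summable_geometric_of_lt_one hτ hτ1).of_nonneg_of_le (fun n => by positivity)
    fun n => ?_
  rw [PowerSeries.coeff_mk, abs_of_nonneg (mul_nonneg (pos n).le (pow_nonneg hτ n)), ← mul_assoc]
  exact mul_le_of_le_one_left (pow_nonneg hτ n) (sqrt_mul_le n)

end invSqrtCoeff

section SqrtAsymptotics

open Filter Topology

lemma tendsto_zero_of_sqrt_mul_tendsto {r : ℕ → ℝ} {L : ℝ}
    (hr : Tendsto (fun n : ℕ => √(n : ℝ) * r n) atTop (𝓝 L)) : Tendsto r atTop (𝓝 0) := by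
  refine (hr.div_atTop (Real.tendsto_sqrt_atTop.comp tendsto_natCast_atTop_atTop)).congr' ?_
  filter_upwards [eventually_gt_atTop 0] with n hn
  have : √(n : ℝ) ≠ 0 := by positivity
  simp only [Function.comp_apply]
  field_simp

lemma sqrt_mul_tendsto_of_one_add_mul_ne_one {f r : ℕ → ℝ} {α L : ℝ} (hα : 0 ≤ α) (hα1 : α ≠ 1)
    (hf : ∀ n, 0 ≤ f n) (hfr : ∀ n, f (n + 1) + α * f n = r (n + 1))
    (hr : Tendsto (fun n : ℕ => √(n : ℝ) * r n) atTop (𝓝 L)) :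
    Tendsto (fun n : ℕ => √(n : ℝ) * f n) atTop (𝓝 (L / (1 + α))) := by
  have hle : ∀ n, 1 ≤ n → f n ≤ r n := by
    intro n hn
    obtain ⟨m, rfl⟩ := Nat.exists_eq_add_of_le' hn
    rw [← hfr m]
    linarith [mul_nonneg hα (hf m)]
  have hf0 : Tendsto f atTop (𝓝 0) :=
    squeeze_zero' (Eventually.of_forall hf) ((eventually_ge_atTop 1).mono hle)
      (tendsto_zero_of_sqrt_mul_tendsto hr)
  have hd : Tendsto (fun n : ℕ => √(n : ℝ) * f n - L / (1 + α)) atTop (𝓝 0) := by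
    refine tendsto_zero_of_add_mul_tendsto_zero hα hα1 (M := |L| + 1 + |L / (1 + α)|) ?_ ?_
    · filter_upwards [eventually_ge_atTop 1, (tendsto_order.mp hr.abs).2 (|L| + 1) (by linarith)]
        with n hn hn2
      refine (abs_sub _ _).trans ?_
      gcongr
      refine le_trans ?_ hn2.le
      rw [abs_mul, abs_mul, abs_of_nonneg (hf n), abs_of_nonneg ((hf n).trans (hle n hn))]
      gcongr
      exact hle n hn
    · have h1 : Tendsto (fun n : ℕ => √((n + 1 : ℕ) : ℝ) * r (n + 1)) atTop (𝓝 L) :=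
        hr.comp (tendsto_add_atTop_nat 1)
      have h2 : Tendsto (fun n : ℕ => (√((n + 1 : ℕ) : ℝ) - √(n : ℝ)) * f n) atTop (𝓝 0) := by
        refine squeeze_zero (fun n => mul_nonneg (sub_nonneg.mpr (Real.sqrt_le_sqrt (by simp)))
          (hf n)) (fun n => mul_le_of_le_one_left (hf n) ?_) hf0
        rw [sub_le_iff_le_add, Real.sqrt_le_left (by positivity), add_sq,
          Real.sq_sqrt (Nat.cast_nonneg n)]
        push_cast
        linarith [Real.sqrt_nonneg (n : ℝ)]
      have h3 := (h1.sub (tendsto_const_nhds (x := L))).sub (h2.const_mul α)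
      rw [sub_self, mul_zero, sub_zero] at h3
      refine h3.congr fun n => ?_
      have : 1 + α ≠ 0 := by positivity
      rw [← hfr n]
      field_simp
      ring
  simpa using hd.add_const (L / (1 + α))

lemma sqrt_mul_tendsto_zero_of_sub_eq {x : ℕ → ℝ} {γ : PowerSeries ℝ}
    (hx : Tendsto x atTop (𝓝 0))
    (hγ : ∀ n, x (n + 2) - x n = PowerSeries.coeff (n + 2) γ)
    (hs : SqrtWeightSummable γ) : Tendsto (fun n : ℕ => √(n : ℝ) * x n) atTop (𝓝 0) := by
  set u : ℕ → ℝ := fun m => √((m : ℝ) + 1) * |PowerSeries.coeff m γ| with hu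
  have hunn : ∀ m, 0 ≤ u m := fun m => by positivity
  have htail : ∀ n : ℕ, Summable fun m => u (m + n) := fun n => (summable_nat_add_iff n).mpr hs
  have hle : ∀ n K : ℕ, √(n : ℝ) * |x n| ≤
      √(n : ℝ) * |x (n + 2 * K)| + ∑ m ∈ Finset.range (2 * K + 1), u (m + n) := by
    intro n K
    induction K with
    | zero => simpa using hunn _
    | succ K ih =>
      refine ih.trans ?_
      rw [show 2 * (K + 1) + 1 = 2 * K + 1 + 1 + 1 by ring, Finset.sum_range_succ _ (2 * K + 1 + 1),
        Finset.sum_range_succ _ (2 * K + 1)]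
      have h1 : |x (n + 2 * K)| ≤
          |x (n + 2 * (K + 1))| + |PowerSeries.coeff (n + 2 * K + 2) γ| := by
        rw [← hγ]
        have := abs_sub (x (n + 2 * K + 2)) (x (n + 2 * K + 2) - x (n + 2 * K))
        rwa [sub_sub_cancel] at this
      have h2 : √(n : ℝ) * |PowerSeries.coeff (n + 2 * K + 2) γ| ≤ u (2 * K + 1 + 1 + n) := by
        rw [hu, show 2 * K + 1 + 1 + n = n + 2 * K + 2 by ring]
        dsimp only
        gcongr
        push_cast
        linarith [Nat.cast_nonneg (α := ℝ) K]
      have h3 := mul_le_mul_of_nonneg_left h1 (Real.sqrt_nonneg (n : ℝ))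
      linarith [hunn (2 * K + 1 + n)]
  have hle' : ∀ n : ℕ, √(n : ℝ) * |x n| ≤ ∑' m, u (m + n) := by
    intro n
    have h1 : Tendsto (fun K : ℕ => √(n : ℝ) * |x (n + 2 * K)| + ∑' m, u (m + n)) atTop
        (𝓝 (√(n : ℝ) * |0| + ∑' m, u (m + n))) := by
      refine ((hx.abs.comp ?_).const_mul _).add_const _
      exact tendsto_atTop_mono (fun K => by simp only [id]; omega) tendsto_id
    rw [abs_zero, mul_zero, zero_add] at h1
    refine ge_of_tendsto' h1 fun K => (hle n K).trans ?_
    gcongr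
    exact (htail n).sum_le_tsum _ fun m _ => hunn _
  refine squeeze_zero_norm (fun n => ?_) (tendsto_sum_nat_add u)
  rw [norm_mul, Real.norm_of_nonneg (Real.sqrt_nonneg _)]
  exact hle' n

/-- If `(1 + αX) f = r` with nonnegative `f`, then `n^{-1/2}`-asymptotics of `r` transfer to `f`. -/
lemma sqrt_mul_coeff_tendsto_of_one_add_mul {f r : PowerSeries ℝ} {α L : ℝ} (hα : 0 ≤ α)
    (hf : ∀ n, 0 ≤ PowerSeries.coeff n f)
    (hfr : (PowerSeries.C 1 + PowerSeries.C α * PowerSeries.X) * f = r)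
    (hr : Tendsto (fun n : ℕ => √(n : ℝ) * PowerSeries.coeff n r) atTop (𝓝 L))
    (hs : α = 1 → SqrtWeightSummable ((1 - PowerSeries.X) ^ 2 * r)) :
    Tendsto (fun n : ℕ => √(n : ℝ) * PowerSeries.coeff n f) atTop (𝓝 (L / (1 + α))) := by
  have hrec : ∀ n, PowerSeries.coeff (n + 1) f + α * PowerSeries.coeff n f =
      PowerSeries.coeff (n + 1) r := by
    intro n
    rw [← hfr, map_one, add_mul, one_mul, mul_assoc, map_add, PowerSeries.coeff_C_mul,
      PowerSeries.coeff_succ_X_mul]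
  by_cases hα1 : α = 1
  swap
  · exact sqrt_mul_tendsto_of_one_add_mul_ne_one hα hα1 hf hrec hr
  subst hα1
  have hr0 := tendsto_zero_of_sqrt_mul_tendsto hr
  have hf0 : Tendsto (fun n => PowerSeries.coeff n f) atTop (𝓝 0) := by
    refine squeeze_zero' (Eventually.of_forall hf) ?_ hr0
    filter_upwards [eventually_ge_atTop 1] with n hn
    obtain ⟨m, rfl⟩ := Nat.exists_eq_add_of_le' hn
    linarith [hrec m, hf m]
  have hx := sqrt_mul_tendsto_zero_of_sub_eq (γ := (1 - PowerSeries.X) ^ 2 * r)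
    (x := fun n => PowerSeries.coeff n ((1 - PowerSeries.X) * f)) ?_ ?_ (hs rfl)
  · refine ((hr.add hx).div_const 2).congr' ?_ |>.trans (by norm_num)
    filter_upwards [eventually_ge_atTop 1] with n hn
    obtain ⟨m, rfl⟩ := Nat.exists_eq_add_of_le' hn
    rw [← hrec m, sub_mul, one_mul, map_sub, PowerSeries.coeff_succ_X_mul]
    ring_nf
  · rw [← tendsto_add_atTop_iff_nat 1]
    have := (hf0.comp (tendsto_add_atTop_nat 1)).sub hf0
    rw [sub_zero] at this
    refine this.congr fun n => ?_
    rw [sub_mul, one_mul, map_sub, PowerSeries.coeff_succ_X_mul]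
    rfl
  · intro n
    have h1 : (1 - PowerSeries.X) ^ 2 * r =
        (1 - PowerSeries.X) * f - PowerSeries.X * (PowerSeries.X * ((1 - PowerSeries.X) * f)) := by
      rw [← hfr, map_one]
      ring
    rw [h1, map_sub, PowerSeries.coeff_succ_X_mul, PowerSeries.coeff_succ_X_mul]

end SqrtAsymptotics

/-- A bounded solution of a three-term recurrence whose characteristic polynomial is negative
at `1` is driven by the smaller characteristic root. -/
lemma bounded_recurrence_first_step {q : ℕ → ℝ} {A B C M : ℝ} (hA : 0 < A)
    (hneg : A - B + C < 0) (hrec : ∀ i, A * q (i + 2) = B * q (i + 1) - C * q i)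
    (hM : ∀ i, |q i| ≤ M) : 2 * A * q 1 = (B - √(B ^ 2 - 4 * A * C)) * q 0 := by
  set D := √(B ^ 2 - 4 * A * C) with hD
  have hDlt : |2 * A - B| < D := by
    refine Real.lt_sqrt_of_sq_lt ?_
    rw [sq_abs]
    nlinarith [mul_neg_of_pos_of_neg hA hneg]
  have hD2 : D ^ 2 = B ^ 2 - 4 * A * C := by
    refine Real.sq_sqrt ?_
    by_contra! h
    rw [Real.sqrt_eq_zero_of_nonpos h.le] at hD
    linarith [abs_nonneg (2 * A - B)]
  set e : ℕ → ℝ := fun i => 2 * A * q (i + 1) - (B - D) * q i with he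
  have hstep : ∀ i, e i = ((B + D) / (2 * A)) ^ i * e 0 := by
    intro i
    induction i with
    | zero => simp
    | succ i ih =>
      rw [pow_succ, mul_right_comm, ← ih, he]
      simp only
      field_simp
      linear_combination 4 * A * hrec i - q i * hD2
  have hbound : ∀ i, |e i| ≤ 2 * A * M + |B - D| * M := by
    intro i
    refine (abs_sub _ _).trans ?_
    rw [abs_mul (2 * A), abs_mul (B - D), abs_of_pos (by positivity : 0 < 2 * A)]
    gcongr <;> exact hM _
  have hgt : 1 < (B + D) / (2 * A) := by
    rw [one_lt_div (by positivity)]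
    linarith [(abs_lt.mp hDlt).2]
  by_contra hne
  have he0 : 0 < |e 0| := by
    rw [abs_pos]
    exact fun h => hne (by linarith [show e 0 = 2 * A * q 1 - (B - D) * q 0 from rfl])
  obtain ⟨n, hn⟩ := pow_unbounded_of_one_lt ((2 * A * M + |B - D| * M) / |e 0|) hgt
  rw [div_lt_iff₀ he0] at hn
  have := hbound n
  rw [hstep, abs_mul, abs_of_pos (by positivity)] at this
  linarith

section GeneratingFunctions

variable {p q mh ml : ℝ} {pi : ℕ → ℕ → ℝ}

/-- The generating function of the `i`-th row of `pi`. -/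
noncomputable def rowGF (pi : ℕ → ℕ → ℝ) (i : ℕ) (y : ℝ) : ℝ := ∑' j, pi i j * y ^ j

lemma rowGF_summable (hnn : ∀ i j : ℕ, 0 ≤ pi i j)
    (hsum : HasSum (fun ij : ℕ × ℕ => pi ij.1 ij.2) 1) (i : ℕ) {y : ℝ}
    (hy : y ∈ Set.Ioo (0 : ℝ) 1) : Summable fun j => pi i j * y ^ j :=
  (hsum.summable.prod_factor i).of_nonneg_of_le
    (fun j => mul_nonneg (hnn i j) (pow_nonneg hy.1.le j))
    (fun j => mul_le_of_le_one_right (hnn i j) (pow_le_one₀ hy.1.le hy.2.le))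

lemma rowGF_nonneg (hnn : ∀ i j : ℕ, 0 ≤ pi i j) (i : ℕ) {y : ℝ}
    (hy : y ∈ Set.Ioo (0 : ℝ) 1) : 0 ≤ rowGF pi i y :=
  tsum_nonneg fun j => mul_nonneg (hnn i j) (pow_nonneg hy.1.le j)

lemma rowGF_le_one (hnn : ∀ i j : ℕ, 0 ≤ pi i j)
    (hsum : HasSum (fun ij : ℕ × ℕ => pi ij.1 ij.2) 1) (i : ℕ) {y : ℝ}
    (hy : y ∈ Set.Ioo (0 : ℝ) 1) : rowGF pi i y ≤ 1 := by
  have hrow := hsum.prod_fiberwise fun i => (hsum.summable.prod_factor i).hasSum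
  refine le_trans ?_ (le_hasSum hrow i fun k _ => tsum_nonneg fun j => hnn k j)
  exact (rowGF_summable hnn hsum i hy).tsum_le_tsum
    (fun j => mul_le_of_le_one_right (hnn i j) (pow_le_one₀ hy.1.le hy.2.le))
    (hsum.summable.prod_factor i)

lemma rowGF_shift (hnn : ∀ i j : ℕ, 0 ≤ pi i j)
    (hsum : HasSum (fun ij : ℕ × ℕ => pi ij.1 ij.2) 1) (i : ℕ) {y : ℝ}
    (hy : y ∈ Set.Ioo (0 : ℝ) 1) :
    HasSum (fun j => pi i j * y ^ (j + 1)) (y * rowGF pi i y) ∧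
      HasSum (fun j => pi i (j + 1) * y ^ (j + 1)) (rowGF pi i y - pi i 0) ∧
      HasSum (fun j => pi i (j + 2) * y ^ (j + 1)) ((rowGF pi i y - pi i 0 - pi i 1 * y) / y) := by
  have h := (rowGF_summable hnn hsum i hy).hasSum
  have hy0 : y ≠ 0 := hy.1.ne'
  refine ⟨?_, ?_, ?_⟩
  · refine (h.mul_left y).congr_fun ?_
    intro j
    ring
  · simpa [rowGF] using (hasSum_nat_add_iff' 1).mpr h
  · have h2 := ((hasSum_nat_add_iff' 2).mpr h).div_const y
    simp only [Finset.sum_range_succ, Finset.sum_range_zero, zero_add, pow_zero, mul_one,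
      pow_one, ← sub_sub] at h2
    refine h2.congr_fun ?_
    intro j
    field_simp
    ring

lemma rowGF_interior (hnn : ∀ i j : ℕ, 0 ≤ pi i j)
    (hsum : HasSum (fun ij : ℕ × ℕ => pi ij.1 ij.2) 1)
    (hbal : BalanceEquations p q mh ml pi) {y : ℝ} (hy : y ∈ Set.Ioo (0 : ℝ) 1) (i : ℕ) :
    (q * y + 1 - q) * ((1 - p) * mh) * rowGF pi (i + 2) y =
      (1 - (q * y + 1 - q) * ((1 - p) * (1 - mh) + p * mh)) * rowGF pi (i + 1) y -
        (q * y + 1 - q) * (p * (1 - mh)) * rowGF pi i y := by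
  obtain ⟨-, h0, -, h⟩ := hbal
  have h0 := h0 (i + 1) (by omega)
  have h := fun j => h (i + 1) (j + 1) (by omega) (by omega)
  simp only [Nat.add_sub_cancel] at h0 h
  obtain ⟨a1, a2, -⟩ := rowGF_shift hnn hsum i hy
  obtain ⟨b1, b2, -⟩ := rowGF_shift hnn hsum (i + 1) hy
  obtain ⟨c1, c2, -⟩ := rowGF_shift hnn hsum (i + 2) hy
  have hL := b2.mul_left (1 - ((1-p)*(1-q)*(1-mh) + p*(1-q)*mh))
  have hR := ((((a2.mul_left (p*(1-q)*(1-mh))).add (c2.mul_left ((1-p)*(1-q)*mh))).add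
    (c1.mul_left ((1-p)*q*mh))).add (b1.mul_left (p*q*mh + (1-p)*q*(1-mh)))).add
    (a1.mul_left (p*q*(1-mh)))
  have := hL.unique (hR.congr_fun fun j => by linear_combination y ^ (j + 1) * h j)
  linear_combination -this - h0

lemma rowGF_boundary (hnn : ∀ i j : ℕ, 0 ≤ pi i j)
    (hsum : HasSum (fun ij : ℕ × ℕ => pi ij.1 ij.2) 1)
    (hbal : BalanceEquations p q mh ml pi) {y : ℝ} (hy : y ∈ Set.Ioo (0 : ℝ) 1) :
    (y - (q * y + 1 - q) * (p * mh * y + (1 - p) * ((1 - ml) * y + ml))) * rowGF pi 0 y =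
      y * (q * y + 1 - q) * ((1 - p) * mh) * rowGF pi 1 y -
        pi 0 0 * ((1 - p) * (1 - q) * ml) * (1 - y) := by
  obtain ⟨h0, -, h, -⟩ := hbal
  have h := fun j => h (j + 1) (by omega)
  simp only [Nat.add_sub_cancel] at h
  obtain ⟨a1, a2, a3⟩ := rowGF_shift hnn hsum 0 hy
  obtain ⟨b1, b2, -⟩ := rowGF_shift hnn hsum 1 hy
  have hL := a2.mul_left (1 - ((1-p)*(1-q)*(1-ml) + p*(1-q)*mh + (1-p)*q*ml))
  have hR := (((a1.mul_left (p*q*mh + (1-p)*q*(1-ml))).add (a3.mul_left ((1-p)*(1-q)*ml))).add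
    (b1.mul_left ((1-p)*q*mh))).add (b2.mul_left ((1-p)*(1-q)*mh))
  have := hL.unique (hR.congr_fun fun j => by linear_combination y ^ (j + 1) * h j)
  have hy0 : y ≠ 0 := hy.1.ne'
  field_simp at this
  linear_combination this + y * h0

lemma rowGF_one (hp : p ∈ Set.Ioo (0 : ℝ) 1) (hq : q ∈ Set.Ioo (0 : ℝ) 1)
    (hmh : mh ∈ Set.Ioo (0 : ℝ) 1) (hnn : ∀ i j : ℕ, 0 ≤ pi i j)
    (hsum : HasSum (fun ij : ℕ × ℕ => pi ij.1 ij.2) 1)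
    (hbal : BalanceEquations p q mh ml pi) {y : ℝ} (hy : y ∈ Set.Ioo (0 : ℝ) 1) :
    2 * ((q * y + 1 - q) * ((1 - p) * mh)) * rowGF pi 1 y =
      (1 - (q * y + 1 - q) * ((1 - p) * (1 - mh) + p * mh) -
        √((1 - (q * y + 1 - q) * ((1 - p) * (1 - mh) + p * mh)) ^ 2 -
          4 * ((q * y + 1 - q) * ((1 - p) * mh)) * ((q * y + 1 - q) * (p * (1 - mh))))) *
        rowGF pi 0 y := by
  obtain ⟨hp0, hp1⟩ := hp
  obtain ⟨hq0, hq1⟩ := hq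
  obtain ⟨hy0, hy1⟩ := hy
  have hs : 0 < q * y + 1 - q := by nlinarith
  refine bounded_recurrence_first_step (q := fun i => rowGF pi i y) (M := 1)
    (mul_pos hs (mul_pos (by linarith) hmh.1)) ?_
    (rowGF_interior hnn hsum hbal ⟨hy0, hy1⟩) fun i => ?_
  · nlinarith
  · rw [abs_of_nonneg (rowGF_nonneg hnn i ⟨hy0, hy1⟩)]
    exact rowGF_le_one hnn hsum i ⟨hy0, hy1⟩

lemma pi_zero_zero_pos (hp : p ∈ Set.Ioo (0 : ℝ) 1) (hq : q ∈ Set.Ioo (0 : ℝ) 1)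
    (hmh : mh ∈ Set.Ioo (0 : ℝ) 1) (hnn : ∀ i j : ℕ, 0 ≤ pi i j)
    (hsum : HasSum (fun ij : ℕ × ℕ => pi ij.1 ij.2) 1)
    (hbal : BalanceEquations p q mh ml pi) {y : ℝ} (hy : y ∈ Set.Ioo (0 : ℝ) 1)
    (himp : pi 0 0 = 0 → rowGF pi 0 y = 0) : 0 < pi 0 0 := by
  refine (hnn 0 0).lt_of_ne' fun h00 => ?_
  have hs : 0 < q * y + 1 - q := by nlinarith [mul_pos hq.1 hy.1, hq.2]
  have hA : 0 < (q * y + 1 - q) * ((1 - p) * mh) :=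
    mul_pos hs (mul_pos (by linarith [hp.2]) hmh.1)
  have h0 := himp h00
  have h1 : rowGF pi 1 y = 0 := by
    have := rowGF_one hp hq hmh hnn hsum hbal hy
    rw [h0, mul_zero] at this
    exact (mul_eq_zero.mp this).resolve_left (by positivity)
  have hall : ∀ i, rowGF pi i y = 0 ∧ rowGF pi (i + 1) y = 0 := by
    intro i
    induction i with
    | zero => exact ⟨h0, h1⟩
    | succ i ih =>
      refine ⟨ih.2, ?_⟩
      have := rowGF_interior hnn hsum hbal hy i
      rw [ih.1, ih.2, mul_zero, mul_zero, sub_zero] at this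
      exact (mul_eq_zero.mp this).resolve_left hA.ne'
  have hz : ∀ ij : ℕ × ℕ, pi ij.1 ij.2 = 0 := by
    intro ij
    have h2 := (hasSum_zero_iff_of_nonneg
      (fun j => mul_nonneg (hnn ij.1 j) (pow_nonneg hy.1.le j))).mp
      ((rowGF_summable hnn hsum ij.1 hy).hasSum_iff.mpr (hall ij.1).1)
    exact (mul_eq_zero.mp (congrFun h2 ij.2)).resolve_right (pow_ne_zero _ hy.1.ne')
  simp only [hz] at hsum
  exact zero_ne_one (hasSum_zero.unique hsum)

end GeneratingFunctions

open Filter Topology in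
/-- Darboux-type transfer for a nonnegative power series whose product with
`(1 + σ z) (1 + θ z)` is a polynomial plus `κ z √(1 - τ z) / √(1 - z)`. -/
lemma sqrt_mul_coeff_tendsto_of_evaluatesTo {f : PowerSeries ℝ} {σ θ τ f0 f1 κ δ : ℝ}
    (hf : ∀ n, 0 ≤ PowerSeries.coeff n f) (hσ : 0 ≤ σ) (hσ1 : σ ≠ 1) (hθ : 0 ≤ θ) (hτ : 0 ≤ τ)
    (hτ1 : τ < 1) (hδ : 0 < δ) (hδ1 : δ ≤ 1)
    (h : ∀ z ∈ Set.Ioo 0 δ, ∃ v, EvaluatesTo f z v ∧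
      (1 + θ * z) * ((1 + σ * z) * v) = f0 + f1 * z + κ * z * √(1 - τ * z) / √(1 - z)) :
    Tendsto (fun n : ℕ => √(n : ℝ) * PowerSeries.coeff n f) atTop
      (𝓝 (κ * √(1 - τ) / √Real.pi / (1 + θ) / (1 + σ))) := by
  set g : PowerSeries ℝ := PowerSeries.mk fun n => invSqrtCoeff n * τ ^ n with hg
  set k : PowerSeries ℝ := PowerSeries.C κ * PowerSeries.X *
    (PowerSeries.C 1 + PowerSeries.C (-τ) * PowerSeries.X) * g with hk
  set r : PowerSeries ℝ := PowerSeries.C f0 + PowerSeries.C f1 * PowerSeries.X +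
    k * invSqrtCoeff.series with hr
  have hseries : invSqrtCoeff.series =
      PowerSeries.mk fun n => invSqrtCoeff n * (1 : ℝ) ^ n := by
    simp [invSqrtCoeff.series]
  have hkeval : ∀ z, 0 ≤ z → τ * z < 1 → EvaluatesTo k z (κ * z * √(1 - τ * z)) := by
    intro z hz hz1
    have := (((EvaluatesTo.C κ).mul EvaluatesTo.X).mul
      ((EvaluatesTo.C 1).add ((EvaluatesTo.C (-τ)).mul EvaluatesTo.X))).mul
      (invSqrtCoeff.evaluatesTo hτ hz hz1)
    convert this using 1
    have h0 : 0 < 1 - τ * z := by linarith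
    have h1 : √(1 - τ * z) ≠ 0 := by positivity
    rw [mul_one_div, eq_div_iff h1, mul_assoc, Real.mul_self_sqrt h0.le]
    ring
  have hksum : SqrtWeightSummable k := by
    have hcoe : ((Polynomial.C κ * Polynomial.X *
        (Polynomial.C 1 + Polynomial.C (-τ) * Polynomial.X) : Polynomial ℝ) : PowerSeries ℝ) =
        PowerSeries.C κ * PowerSeries.X *
          (PowerSeries.C 1 + PowerSeries.C (-τ) * PowerSeries.X) := by
      simp only [Polynomial.coe_mul, Polynomial.coe_add, Polynomial.coe_C, Polynomial.coe_X]
    rw [hk, ← hcoe]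
    exact (SqrtWeightSummable.of_polynomial _).mul
      (invSqrtCoeff.sqrtWeightSummable_geometric hτ hτ1)
  have hpoly : SqrtWeightSummable (PowerSeries.C f0 + PowerSeries.C f1 * PowerSeries.X) := by
    rw [← Polynomial.coe_C, ← Polynomial.coe_C, ← Polynomial.coe_X, ← Polynomial.coe_mul,
      ← Polynomial.coe_add]
    exact SqrtWeightSummable.of_polynomial _
  have hrlim : Tendsto (fun n : ℕ => √(n : ℝ) * PowerSeries.coeff n r) atTop
      (𝓝 (κ * √(1 - τ) / √Real.pi)) := by
    have hk1 : EvaluatesTo k 1 (κ * √(1 - τ)) := by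
      simpa using hkeval 1 zero_le_one (by linarith)
    have h2 := hpoly.tendsto_zero.add (hksum.tendsto_coeff_mul hk1
      (g := invSqrtCoeff.series) (fun n => by
        simpa [invSqrtCoeff.series, abs_of_pos (invSqrtCoeff.pos n)] using
          invSqrtCoeff.sqrt_mul_le n)
      (by simpa [invSqrtCoeff.series] using invSqrtCoeff.tendsto_sqrt_mul))
    rw [zero_add, ← div_eq_mul_inv] at h2
    refine h2.congr fun n => ?_
    rw [hr, map_add _ _ (k * _)]
    ring
  have hrsum : SqrtWeightSummable ((1 - PowerSeries.X) ^ 2 * r) := by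
    have h1 : SqrtWeightSummable ((1 - PowerSeries.X) ^ 2 : PowerSeries ℝ) := by
      rw [← Polynomial.coe_one, ← Polynomial.coe_X, ← Polynomial.coe_sub, ← Polynomial.coe_pow]
      exact SqrtWeightSummable.of_polynomial _
    have := (h1.mul hpoly).add (hksum.mul invSqrtCoeff.sqrtWeightSummable_sq_mul_series)
    convert this using 1
    rw [hr]
    ring
  have hid : (PowerSeries.C 1 + PowerSeries.C θ * PowerSeries.X) *
      ((PowerSeries.C 1 + PowerSeries.C σ * PowerSeries.X) * f) = r := by
    refine EvaluatesTo.eq_of_forall hδ fun z hz => ?_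
    obtain ⟨v, hv, hvz⟩ := h z hz
    refine ⟨_, ((EvaluatesTo.C 1).add ((EvaluatesTo.C θ).mul EvaluatesTo.X)).mul
      (((EvaluatesTo.C 1).add ((EvaluatesTo.C σ).mul EvaluatesTo.X)).mul hv), ?_⟩
    rw [hvz, hr, hseries, ← mul_one_div]
    refine ((EvaluatesTo.C f0).add ((EvaluatesTo.C f1).mul EvaluatesTo.X)).add
      (EvaluatesTo.mul (hkeval z hz.1.le ?_) ?_)
    · nlinarith [hz.1, hz.2]
    · have := invSqrtCoeff.evaluatesTo zero_le_one hz.1.le (by linarith [hz.2] : (1 : ℝ) * z < 1)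
      rwa [one_mul] at this
  have hnn : ∀ n, 0 ≤ PowerSeries.coeff n
      ((PowerSeries.C 1 + PowerSeries.C σ * PowerSeries.X) * f) := by
    intro n
    rw [add_mul, map_add, map_one, one_mul, mul_assoc, PowerSeries.coeff_C_mul]
    refine add_nonneg (hf n) (mul_nonneg hσ ?_)
    cases n with
    | zero => simp
    | succ n => simpa [PowerSeries.coeff_succ_X_mul] using hf n
  exact sqrt_mul_coeff_tendsto_of_one_add_mul hσ hf rfl
    (sqrt_mul_coeff_tendsto_of_one_add_mul hθ hnn hid hrlim fun _ => hrsum)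
    fun hσ' => absurd hσ' hσ1

section BranchPoints

variable {p q mh ml y0 y1 : ℝ}

/-- The branch points lie to the right of `1`, and `q y + 1 - q` is there the reciprocal of
`(√((1 - p)(1 - mh)) ± √(p mh))²`. -/
lemma branchPoints_spec (hp : p ∈ Set.Ioo (0 : ℝ) 1) (hq : q ∈ Set.Ioo (0 : ℝ) 1)
    (hmh : mh ∈ Set.Ioo (0 : ℝ) 1) (hpmh : p < mh) (hD : p + mh < 1)
    (hy0 : y0 = (p*mh + (1-p)*(1-mh) - 2*√(p*mh*(1-p)*(1-mh)))
      / ((p*mh - (1-p)*(1-mh))^2 * q) - (1-q)/q)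
    (hy1 : y1 = (p*mh + (1-p)*(1-mh) + 2*√(p*mh*(1-p)*(1-mh)))
      / ((p*mh - (1-p)*(1-mh))^2 * q) - (1-q)/q) :
    (q * y0 + 1 - q) * (p*mh + (1-p)*(1-mh) + 2*√(p*mh*(1-p)*(1-mh))) = 1 ∧
      (q * y1 + 1 - q) * (p*mh + (1-p)*(1-mh) - 2*√(p*mh*(1-p)*(1-mh))) = 1 ∧
      1 < y0 ∧ y0 < y1 := by
  obtain ⟨hp0, hp1⟩ := hp
  obtain ⟨hq0, hq1⟩ := hq
  obtain ⟨hmh0, hmh1⟩ := hmh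
  have hp1' : 0 < 1 - p := by linarith
  have hmh1' : 0 < 1 - mh := by linarith
  have hw2 : √(p*mh*(1-p)*(1-mh)) ^ 2 = p*mh*(1-p)*(1-mh) := Real.sq_sqrt (by positivity)
  have hw0 : 0 < √(p*mh*(1-p)*(1-mh)) := Real.sqrt_pos.mpr (by positivity)
  set w := √(p*mh*(1-p)*(1-mh)) with hw
  have hD0 : (p*mh - (1-p)*(1-mh)) ≠ 0 := by nlinarith
  have hprod : (p*mh + (1-p)*(1-mh) - 2*w) * (p*mh + (1-p)*(1-mh) + 2*w) =
      (p*mh - (1-p)*(1-mh))^2 := by linear_combination -4 * hw2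
  have h0 : (q * y0 + 1 - q) * (p*mh + (1-p)*(1-mh) + 2*w) = 1 := by
    rw [hy0]
    field_simp
    linear_combination hprod
  have h1 : (q * y1 + 1 - q) * (p*mh + (1-p)*(1-mh) - 2*w) = 1 := by
    rw [hy1]
    field_simp
    linear_combination hprod
  have hlt : p*mh + (1-p)*(1-mh) + 2*w < 1 := by
    have : w < ((1-p)*mh + p*(1-mh))/2 := by
      refine lt_of_pow_lt_pow_left₀ 2 (by positivity) ?_
      rw [hw2]
      nlinarith [sq_pos_of_pos (sub_pos.mpr hpmh)]
    linarith
  have hpos : 0 < p*mh + (1-p)*(1-mh) + 2*w := by positivity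
  refine ⟨h0, h1, ?_, ?_⟩
  · by_contra! hle
    have hle1 : q * y0 + 1 - q ≤ 1 := by linarith [mul_le_mul_of_nonneg_left hle hq0.le]
    linarith [mul_le_mul_of_nonneg_right hle1 hpos.le]
  · rw [hy0, hy1]
    have : 0 < (p*mh - (1-p)*(1-mh))^2 := by positivity
    gcongr
    linarith

lemma discriminant_eq_branchPoints (hp : p ∈ Set.Ioo (0 : ℝ) 1) (hmh : mh ∈ Set.Ioo (0 : ℝ) 1)
    (h0 : (q * y0 + 1 - q) * (p*mh + (1-p)*(1-mh) + 2*√(p*mh*(1-p)*(1-mh))) = 1)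
    (h1 : (q * y1 + 1 - q) * (p*mh + (1-p)*(1-mh) - 2*√(p*mh*(1-p)*(1-mh))) = 1) (y : ℝ) :
    (1 - (q * y + 1 - q) * ((1 - p) * (1 - mh) + p * mh)) ^ 2 -
          4 * ((q * y + 1 - q) * ((1 - p) * mh)) * ((q * y + 1 - q) * (p * (1 - mh))) =
      ((1 - p - mh) * q) ^ 2 * ((y0 - y) * (y1 - y)) := by
  have hp1 : 0 ≤ 1 - p := by linarith [hp.2]
  have hmh1 : 0 ≤ 1 - mh := by linarith [hmh.2]
  have hw2 : √(p*mh*(1-p)*(1-mh)) ^ 2 = p*mh*(1-p)*(1-mh) :=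
    Real.sq_sqrt (mul_nonneg (mul_nonneg (mul_nonneg hp.1.le hmh.1.le) hp1) hmh1)
  set w := √(p*mh*(1-p)*(1-mh)) with hw
  set C := p*mh + (1-p)*(1-mh) with hC
  have e0 : 1 - (q * y + 1 - q) * (C + 2*w) = q * (y0 - y) * (C + 2*w) := by
    linear_combination -h0
  have e1 : 1 - (q * y + 1 - q) * (C - 2*w) = q * (y1 - y) * (C - 2*w) := by
    linear_combination -h1
  have e2 : (C + 2*w) * (C - 2*w) = (1 - p - mh) ^ 2 := by
    rw [hC]; linear_combination -4 * hw2
  linear_combination (1 - (q * y + 1 - q) * (C - 2*w)) * e0 + q * (y0 - y) * (C + 2*w) * e1 +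
    q^2 * (y0 - y) * (y1 - y) * e2 + 4 * (q * y + 1 - q)^2 * hw2

/-- When `F` vanishes at the first branch point, that point satisfies `q y0 < 1 - q`. -/
lemma mul_branchPoint_lt (hp : p ∈ Set.Ioo (0 : ℝ) 1) (hq : q ∈ Set.Ioo (0 : ℝ) 1)
    (hmh : mh ∈ Set.Ioo (0 : ℝ) 1) (hml : ml ∈ Set.Ioo (0 : ℝ) 1)
    (hpar : p + q + mh + ml = 1) (hpmh : p < mh) (hmu : ml ≤ mh)
    (h0 : (q * y0 + 1 - q) * (p*mh + (1-p)*(1-mh) + 2*√(p*mh*(1-p)*(1-mh))) = 1)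
    (hF : (q * y0 + 1 - q) * (((1-p) + mh - 2*(1-p)*ml) * y0 + 2*(1-p)*ml) = y0) :
    q * y0 < 1 - q := by
  obtain ⟨hp0, hp1⟩ := hp
  obtain ⟨hq0, hq1⟩ := hq
  obtain ⟨hmh0, hmh1⟩ := hmh
  obtain ⟨hml0, hml1⟩ := hml
  have hp1' : 0 < 1 - p := by linarith
  have hmh1' : 0 < 1 - mh := by linarith
  have hA : 0 < (1-p)*mh := by positivity
  have hB : 0 < p*(1-mh) := by positivity
  set a := √((1-p)*mh) with ha
  set b := √(p*(1-mh)) with hb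
  set m := √((1-p)*ml) with hm
  have ha2 : a ^ 2 = (1-p)*mh := Real.sq_sqrt hA.le
  have hb2 : b ^ 2 = p*(1-mh) := Real.sq_sqrt hB.le
  have hm2 : m ^ 2 = (1-p)*ml := Real.sq_sqrt (by positivity)
  have ha0 : 0 < a := Real.sqrt_pos.mpr hA
  have hm0 : 0 < m := Real.sqrt_pos.mpr (by positivity)
  have hma : m ≤ a := Real.sqrt_le_sqrt (by gcongr)
  have hw : √(p*mh*(1-p)*(1-mh)) = a * b := by
    rw [ha, hb, ← Real.sqrt_mul hA.le]
    congr 1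
    ring
  have hba : b < a := Real.sqrt_lt_sqrt hB.le (by nlinarith)
  set t := a - b with ht
  have ht0 : 0 < t := sub_pos.mpr hba
  have hh : p*mh + (1-p)*(1-mh) + 2*√(p*mh*(1-p)*(1-mh)) = 1 - t^2 := by
    rw [hw, ht]; linear_combination ha2 + hb2
  rw [hh] at h0
  have hs : q * y0 * (1 - t^2) = q + (1-q)*t^2 := by linear_combination h0
  have hy : y0 * (1 - t^2 - ((1-p) + mh - 2*(1-p)*ml)) = 2*(1-p)*ml := by
    linear_combination (-(1 - t^2)) * hF + (((1-p) + mh - 2*(1-p)*ml) * y0 + 2*(1-p)*ml) * h0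
  have hhc : 1 - t^2 - ((1-p) + mh - 2*(1-p)*ml) = 2 * (m^2 - a*t) := by
    rw [hm2, ht]
    linear_combination ha2 - hb2
  have hkey : m^2 * t = a * (q + (1-q)*t^2) := by
    refine mul_right_cancel₀ ht0.ne' ?_
    rw [hhc] at hy
    linear_combination (a*t - m^2) * hs + q * (1 - t^2) / 2 * hy - q * (1 - t^2) * hm2
  clear_value t m
  have hmt : q + (1-q)*t^2 ≤ m * t := by
    have : 0 ≤ q + (1-q)*t^2 := by
      have : 0 ≤ (1-q)*t^2 := mul_nonneg (by linarith) (sq_nonneg _)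
      linarith
    refine le_of_mul_le_mul_left ?_ hm0
    linarith [mul_le_mul_of_nonneg_right hma this]
  have hm3 : m^2 < (1-q)/2 := by
    rw [hm2]; linarith [mul_pos hp0 hml0]
  have ht2 : (1-q)*t^2 < 1/2 - 2*q := by
    have hq' : 0 < 1 - q := by linarith
    have h1 : 2*((1-q)*(m*t)) ≤ (1-q)^2*t^2 + m^2 := by nlinarith [sq_nonneg ((1-q)*t - m)]
    have h2 : (1-q)*(q + (1-q)*t^2) ≤ (1-q)*(m*t) := by gcongr
    refine lt_of_mul_lt_mul_left ?_ hq'.le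
    linarith
  have h5 : 1 < 2*(1-q)*(1-t^2) := by linarith
  have hpos : 0 < 1 - t^2 := by
    refine pos_of_mul_pos_right (zero_lt_one.trans h5) ?_
    linarith
  have : q * y0 + 1 - q < 2 * (1-q) := by
    refine lt_of_mul_lt_mul_right ?_ hpos.le
    linarith
  linarith

end BranchPoints

section Kernel

variable {p q mh ml eta1 eta2 : ℝ} {pi : ℕ → ℕ → ℝ}

lemma eta_spec (hp : p ∈ Set.Ioo (0 : ℝ) 1) (hq : q ∈ Set.Ioo (0 : ℝ) 1)
    (hml : ml ∈ Set.Ioo (0 : ℝ) 1) (hmu : ml ≤ mh)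
    (heta1 : eta1 = ((1 - mh*(1-q) - (1-p)*(1-q)*(1-ml) - (1-p)*q*ml)
        + √((1 - mh*(1-q) - (1-p)*(1-q)*(1-ml) - (1-p)*q*ml)^2
            + 4*(1-p)*(1-q)*(mh - (1-p)*ml)*(1-ml)*q))
        / (2*(1-p)*(1-q)*ml))
    (heta2 : eta2 = ((1 - mh*(1-q) - (1-p)*(1-q)*(1-ml) - (1-p)*q*ml)
        - √((1 - mh*(1-q) - (1-p)*(1-q)*(1-ml) - (1-p)*q*ml)^2
            + 4*(1-p)*(1-q)*(mh - (1-p)*ml)*(1-ml)*q))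
        / (2*(1-p)*(1-q)*ml)) :
    eta2 ≤ 0 ∧ ∀ y, (1-p)*(1-q)*ml^2 * ((1 - eta1*y) * (1 - eta2*y)) =
      (1-p)*(1-q)*ml^2 - ml*(1 - mh*(1-q) - (1-p)*(1-q)*(1-ml) - (1-p)*q*ml)*y
        - (mh - (1-p)*ml)*(1-ml)*q*y^2 := by
  have hp1 : 0 < 1 - p := by linarith [hp.2]
  have hq1 : 0 < 1 - q := by linarith [hq.2]
  have hml0 := hml.1
  have hml1 : 0 < 1 - ml := by linarith [hml.2]
  have hX : 0 < mh - (1-p)*ml := by linarith [mul_pos hp.1 hml0]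
  have hq0 := hq.1
  set E := 1 - mh*(1-q) - (1-p)*(1-q)*(1-ml) - (1-p)*q*ml with hE
  have hK : 0 < 4*(1-p)*(1-q)*(mh - (1-p)*ml)*(1-ml)*q := by positivity
  set K := 4*(1-p)*(1-q)*(mh - (1-p)*ml)*(1-ml)*q with hKdef
  have hR2 : √(E^2 + K) ^ 2 = E^2 + K := Real.sq_sqrt (by positivity)
  have hER : E ≤ √(E^2 + K) := Real.le_sqrt_of_sq_le (by linarith)
  constructor
  · rw [heta2]
    exact div_nonpos_of_nonpos_of_nonneg (by linarith) (by positivity)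
  · intro y
    rw [heta1, heta2]
    field_simp
    linear_combination (-y^2) * hR2 - y^2 * hKdef

lemma kernel_identity
    (heta : ∀ y, (1-p)*(1-q)*ml^2 * ((1 - eta1*y) * (1 - eta2*y)) =
      (1-p)*(1-q)*ml^2 - ml*(1 - mh*(1-q) - (1-p)*(1-q)*(1-ml) - (1-p)*q*ml)*y
        - (mh - (1-p)*ml)*(1-ml)*q*y^2) (y : ℝ) :
    ((q * y + 1 - q) * (((1-p) + mh - 2*(1-p)*ml) * y + 2*(1-p)*ml) - y) ^ 2 - y ^ 2 *
      ((1 - (q * y + 1 - q) * ((1 - p) * (1 - mh) + p * mh)) ^ 2 -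
        4 * ((q * y + 1 - q) * ((1 - p) * mh)) * ((q * y + 1 - q) * (p * (1 - mh)))) =
    (q * y + 1 - q) * (1 - y) * ((2*(1-p)*ml)^2 * (1-q)) * ((1 - eta1*y) * (1 - eta2*y)) := by
  linear_combination (-4 * (1-p) * (q * y + 1 - q) * (1 - y)) * heta y

lemma rowGF_zero (hp : p ∈ Set.Ioo (0 : ℝ) 1) (hq : q ∈ Set.Ioo (0 : ℝ) 1)
    (hmh : mh ∈ Set.Ioo (0 : ℝ) 1) (hml : ml ∈ Set.Ioo (0 : ℝ) 1)
    (hnn : ∀ i j : ℕ, 0 ≤ pi i j)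
    (hsum : HasSum (fun ij : ℕ × ℕ => pi ij.1 ij.2) 1)
    (hbal : BalanceEquations p q mh ml pi)
    (heta : ∀ y, (1-p)*(1-q)*ml^2 * ((1 - eta1*y) * (1 - eta2*y)) =
      (1-p)*(1-q)*ml^2 - ml*(1 - mh*(1-q) - (1-p)*(1-q)*(1-ml) - (1-p)*q*ml)*y
        - (mh - (1-p)*ml)*(1-ml)*q*y^2) {y r : ℝ} (hy : y ∈ Set.Ioo (0 : ℝ) 1) (hr : 0 ≤ r)
    (hr2 : (1 - (q * y + 1 - q) * ((1 - p) * (1 - mh) + p * mh)) ^ 2 -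
        4 * ((q * y + 1 - q) * ((1 - p) * mh)) * ((q * y + 1 - q) * (p * (1 - mh))) = r ^ 2) :
    rowGF pi 0 y * ((q * y + 1 - q) * (2*(1-p)*ml) * ((1 - eta1*y) * (1 - eta2*y))) =
      pi 0 0 * ((q * y + 1 - q) * (((1-p) + mh - 2*(1-p)*ml) * y + 2*(1-p)*ml) - y + y * r) := by
  have hone := rowGF_one hp hq hmh hnn hsum hbal hy
  have hbd := rowGF_boundary hnn hsum hbal hy
  have hker := kernel_identity heta y
  rw [hr2] at hker
  rw [hr2, Real.sqrt_sq hr] at hone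
  have hfun : rowGF pi 0 y *
      ((q * y + 1 - q) * (((1-p) + mh - 2*(1-p)*ml) * y + 2*(1-p)*ml) - y - y * r) =
      2 * pi 0 0 * ((1-p)*(1-q)*ml) * (1 - y) := by
    linear_combination -2 * hbd - y * hone
  have hne : (1 - y) * (2*(1-p)*ml) * (1-q) ≠ 0 :=
    mul_ne_zero (mul_ne_zero (by linarith [hy.2]) (mul_ne_zero
      (mul_ne_zero two_ne_zero (by linarith [hp.2])) hml.1.ne')) (by linarith [hq.2])
  refine mul_left_cancel₀ hne ?_
  linear_combination (-rowGF pi 0 y) * hker +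
    ((q * y + 1 - q) * (((1-p) + mh - 2*(1-p)*ml) * y + 2*(1-p)*ml) - y + y * r) * hfun

end Kernel

/-- geometric decay with prefactor `j^{-1/2}` of the boundary
probabilities when `F(y_0) = 0`. -/
theorem tail_boundary_sqrt_prefactor
    (p q mh ml : ℝ)
    (hp : p ∈ Set.Ioo (0:ℝ) 1) (hq : q ∈ Set.Ioo (0:ℝ) 1)
    (hmh : mh ∈ Set.Ioo (0:ℝ) 1) (hml : ml ∈ Set.Ioo (0:ℝ) 1)
    (hpar : p + q + mh + ml = 1)
    (hrho : p / mh + q / ml < 1)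
    (hmu : ml ≤ mh)
    (F : ℝ → ℝ)
    (hF : ∀ y, F y = ((1-p) + mh - 2*(1-p)*ml)*q*y^2
        + (((1-p) + mh - 2*(1-p)*ml)*(1-q) + 2*(1-p)*q*ml - 1)*y
        + 2*(1-p)*(1-q)*ml)
    (y0 y1 : ℝ)
    (hy0 : y0 = (p*mh + (1-p)*(1-mh) - 2*Real.sqrt (p*mh*(1-p)*(1-mh)))
        / ((p*mh - (1-p)*(1-mh))^2 * q) - (1-q)/q)
    (hy1 : y1 = (p*mh + (1-p)*(1-mh) + 2*Real.sqrt (p*mh*(1-p)*(1-mh)))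
        / ((p*mh - (1-p)*(1-mh))^2 * q) - (1-q)/q)
    (eta1 eta2 : ℝ)
    (heta1 : eta1 = ((1 - mh*(1-q) - (1-p)*(1-q)*(1-ml) - (1-p)*q*ml)
        + Real.sqrt ((1 - mh*(1-q) - (1-p)*(1-q)*(1-ml) - (1-p)*q*ml)^2
            + 4*(1-p)*(1-q)*(mh - (1-p)*ml)*(1-ml)*q))
        / (2*(1-p)*(1-q)*ml))
    (heta2 : eta2 = ((1 - mh*(1-q) - (1-p)*(1-q)*(1-ml) - (1-p)*q*ml)
        - Real.sqrt ((1 - mh*(1-q) - (1-p)*(1-q)*(1-ml) - (1-p)*q*ml)^2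
            + 4*(1-p)*(1-q)*(mh - (1-p)*ml)*(1-ml)*q))
        / (2*(1-p)*(1-q)*ml))
    (pi : ℕ → ℕ → ℝ)
    (hnn : ∀ i j : ℕ, 0 ≤ pi i j)
    (hsum : HasSum (fun ij : ℕ × ℕ => pi ij.1 ij.2) 1)
    (hbal : BalanceEquations p q mh ml pi)
    (a b : ℝ)
    (ha : a = (pi 0 0 / (2*(1-p)*ml)) * (eta1 / (eta1 - eta2)))
    (hb : b = (pi 0 0 / (2*(1-p)*ml)) * (eta2 / (eta2 - eta1)))
    (hFy0 : F y0 = 0)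
    (Cl2 : ℝ)
    (hCl2 : Cl2 = a * ((1-p) - mh) * q * y0 * Real.sqrt (y0 * (y1 - y0))
        / ((q*y0 + 1 - q) * Real.sqrt Real.pi)) :
    Filter.Tendsto (fun j : ℕ => pi 0 j * Real.sqrt j * y0 ^ j)
      Filter.atTop (nhds Cl2) ∧
    Cl2 ≠ 0 := by
  obtain ⟨hmh0, hmh1⟩ := id hmh
  obtain ⟨hml0, hml1⟩ := id hml
  obtain ⟨hp0, hp1⟩ := id hp
  obtain ⟨hq0, hq1⟩ := id hq
  have hp1' : 0 < 1 - p := by linarith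
  have hq1' : 0 < 1 - q := by linarith
  have hpmh : p < mh := by
    have : p / mh < 1 := by linarith [div_pos hq0 hml0]
    rwa [div_lt_one hmh0] at this
  have hD : 0 < 1 - p - mh := by linarith
  obtain ⟨h0, h1, hy01, hy0y1⟩ := branchPoints_spec hp hq hmh hpmh (by linarith) hy0 hy1
  have hdisc := discriminant_eq_branchPoints hp hmh h0 h1
  obtain ⟨heta2_le, heta⟩ := eta_spec hp hq hml hmu heta1 heta2
  have hy0pos : 0 < y0 := by linarith
  have hy1pos : 0 < y1 := by linarith
  have hs0 : 0 < q * y0 + 1 - q := by linarith [mul_pos hq0 hy0pos]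
  rw [hF] at hFy0
  have hFs : (q * y0 + 1 - q) * (((1-p) + mh - 2*(1-p)*ml) * y0 + 2*(1-p)*ml) = y0 := by
    linear_combination hFy0
  have hσlt := mul_branchPoint_lt hp hq hmh hml hpar hpmh hmu h0 hFs
  have heta2y : 0 < 1 - eta2 * y0 := by
    linarith [mul_nonneg (neg_nonneg.mpr heta2_le) hy0pos.le]
  have hd : 0 < 2*(1-p)*ml := by positivity
  have heta1y : eta1 * y0 = 1 := by
    have hker := kernel_identity heta y0
    rw [hdisc, hFs, sub_self, zero_mul, mul_zero, mul_zero, zero_pow two_ne_zero,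
      sub_zero] at hker
    have hne : (q * y0 + 1 - q) * (1 - y0) * ((2*(1-p)*ml)^2 * (1-q)) ≠ 0 :=
      mul_ne_zero (mul_ne_zero hs0.ne' (by linarith)) (by positivity)
    have := (mul_eq_zero.mp hker.symm).resolve_left hne
    linarith [(mul_eq_zero.mp this).resolve_right heta2y.ne']
  have heta1_eq : eta1 = 1 / y0 := by rw [eq_div_iff hy0pos.ne', heta1y]
  have hzero := fun {y r : ℝ} => rowGF_zero hp hq hmh hml hnn hsum hbal heta (y := y) (r := r)
  have hpi : 0 < pi 0 0 := by
    have hhalf : (1 / 2 : ℝ) ∈ Set.Ioo (0 : ℝ) 1 := by norm_num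
    refine pi_zero_zero_pos hp hq hmh hnn hsum hbal hhalf fun h00 => ?_
    have := hzero hhalf (Real.sqrt_nonneg _) (Real.sq_sqrt (by
      rw [hdisc]
      exact mul_nonneg (sq_nonneg _) (mul_nonneg (by linarith) (by linarith)))).symm
    rw [h00, zero_mul] at this
    refine (mul_eq_zero.mp this).resolve_right (mul_ne_zero (mul_ne_zero ?_ hd.ne')
      (mul_ne_zero ?_ ?_))
    · linarith
    · rw [heta1_eq, one_div, inv_mul_eq_div, sub_ne_zero, Ne, eq_div_iff hy0pos.ne']
      linarith
    · linarith
  set σ := q * y0 / (1 - q) with hσ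
  set θ := -eta2 * y0 with hθ
  set τ := y0 / y1 with hτ
  set κ := pi 0 0 * y0 * (1 - p - mh) * q * √(y0 * y1) / (2*(1-p)*ml*(1-q)) with hκ
  have hθ0 : 0 ≤ θ := mul_nonneg (neg_nonneg.mpr heta2_le) hy0pos.le
  have hτ1 : τ < 1 := (div_lt_one hy1pos).mpr hy0y1
  have hlim := sqrt_mul_coeff_tendsto_of_evaluatesTo
    (f := PowerSeries.mk fun n => pi 0 n * y0 ^ n) (σ := σ) (θ := θ) (τ := τ) (κ := κ)
    (f0 := pi 0 0 / (2*(1-p)*ml*(1-q)) * (-y0 * (((1-p) + mh - 2*(1-p)*ml) * q * y0 +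
      (((1-p) + mh - 2*(1-p)*ml)*(1-q) + 2*(1-p)*q*ml - 1))))
    (f1 := pi 0 0 / (2*(1-p)*ml*(1-q)) * (-y0 * (((1-p) + mh - 2*(1-p)*ml) * q * y0)))
    (δ := 1 / y0)
    (fun n => by simpa using mul_nonneg (hnn 0 n) (pow_nonneg hy0pos.le n))
    (by positivity) ((div_lt_one hq1').mpr hσlt).ne hθ0 (by positivity) hτ1 (by positivity)
    ((div_le_one hy0pos).mpr hy01.le) fun z hz => by
      obtain ⟨hz0, hz1⟩ := hz
      have hz1' : z < 1 := hz1.trans ((div_lt_one hy0pos).mpr hy01)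
      have hyz : y0 * z ∈ Set.Ioo (0 : ℝ) 1 :=
        ⟨by positivity, by rwa [lt_div_iff₀' hy0pos] at hz1⟩
      refine ⟨rowGF pi 0 (y0 * z), ?_, ?_⟩
      · have hco : ∀ n, PowerSeries.coeff n (PowerSeries.mk fun n => pi 0 n * y0 ^ n) * z ^ n =
            pi 0 n * (y0 * z) ^ n := fun n => by simp [mul_pow, mul_assoc]
        have hs := rowGF_summable hnn hsum 0 hyz
        simp only [EvaluatesTo, hco]
        exact ⟨hs.norm, hs.hasSum⟩
      · have hz2 : 0 < 1 - z := by linarith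
        have hz3 : 0 < 1 - τ * z := by
          have : τ * z < 1 * 1 := mul_lt_mul'' hτ1 hz1' (by positivity) hz0.le
          linarith
        have hyτ : y1 * τ = y0 := mul_div_cancel₀ _ hy1pos.ne'
        have := hzero hyz (r := (1 - p - mh) * q * √(y0 * y1) * √(1 - z) * √(1 - τ * z))
          (by positivity) (by
            rw [hdisc]
            simp only [mul_pow]
            rw [Real.sq_sqrt (by positivity), Real.sq_sqrt hz2.le, Real.sq_sqrt hz3.le]
            linear_combination ((1 - p - mh)^2 * q^2 * y0 * (1 - z) * z) * hyτ)
        have hs : q * (y0 * z) + 1 - q = (1 - q) * (1 + σ * z) := by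
          rw [hσ]
          field_simp
          ring
        have he1 : 1 - eta1 * (y0 * z) = 1 - z := by linear_combination (-z) * heta1y
        have he2 : 1 - eta2 * (y0 * z) = 1 + θ * z := by rw [hθ]; ring
        have hFz : (q * (y0 * z) + 1 - q) * (((1-p) + mh - 2*(1-p)*ml) * (y0 * z) + 2*(1-p)*ml)
            - y0 * z = (1 - z) * (-y0 * (((1-p) + mh - 2*(1-p)*ml) * q * y0 +
              (((1-p) + mh - 2*(1-p)*ml)*(1-q) + 2*(1-p)*q*ml - 1)) +
              -y0 * (((1-p) + mh - 2*(1-p)*ml) * q * y0) * z) := by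
          linear_combination hFy0
        rw [hFz, hs, he1, he2] at this
        have hrz : √(1 - z) ^ 2 = 1 - z := Real.sq_sqrt hz2.le
        have hrz0 : √(1 - z) ≠ 0 := by positivity
        have hsing : κ * z * √(1 - τ * z) / √(1 - z) * (1 - z) =
            κ * z * √(1 - τ * z) * √(1 - z) := by
          rw [div_mul_eq_mul_div, div_eq_iff hrz0]
          linear_combination (-(κ * z * √(1 - τ * z))) * hrz
        have hκd : κ * (2*(1-p)*ml*(1-q)) = pi 0 0 * y0 * (1 - p - mh) * q * √(y0 * y1) :=
          div_mul_cancel₀ _ (by positivity)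
        have hpid : pi 0 0 / (2*(1-p)*ml*(1-q)) * (2*(1-p)*ml*(1-q)) = pi 0 0 :=
          div_mul_cancel₀ _ (by positivity)
        set π₀ := pi 0 0 / (2*(1-p)*ml*(1-q)) with hπ₀
        have hne : 2*(1-p)*ml*(1-q) * (1 - z) ≠ 0 := by positivity
        refine mul_right_cancel₀ hne ?_
        rw [← hpid] at this hκd
        linear_combination this - 2*(1-p)*ml*(1-q) * hsing - z * √(1 - τ * z) * √(1 - z) * hκd
  have hconst : κ * √(1 - τ) / √Real.pi / (1 + θ) / (1 + σ) = Cl2 := by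
    have hσ1 : 1 + σ = (q * y0 + 1 - q) / (1 - q) := by
      rw [hσ]
      field_simp
      ring
    have heta2_eq : eta2 = -θ / y0 := by
      rw [hθ]
      field_simp
    have hsqrt : √(y0 * (y1 - y0)) = √(y0 * y1) * √(1 - τ) := by
      rw [← Real.sqrt_mul (by positivity)]
      congr 1
      rw [hτ]
      field_simp
    have hθ1 : 1 + θ ≠ 0 := by positivity
    rw [hCl2, ha, heta1_eq, heta2_eq, hsqrt, hσ1, hκ, ← sub_div, sub_neg_eq_add]
    field_simp
  refine ⟨?_, ?_⟩
  · rw [← hconst]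
    refine hlim.congr fun n => ?_
    rw [PowerSeries.coeff_mk]
    ring
  · rw [← hconst]
    have : 0 < 1 - τ := by linarith
    positivity
end
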